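/- arXiv:1409.2813 — 4 statements merged into one kernel-verified Lean document; each statement's English description precedes it below -/
import Mathlib

section
/- For d > 1 and 0 < λ < ∞, the truncated cavity operator T has at most one fixed point in 𝔉: if f, g ∈ 𝔉 satisfy Tf = f and Tg = g, then f = g. -/
open MeasureTheory Set

/-- The truncated cavity operator `T`. -/
noncomputable def T (d lam : ℝ) (f : ℝ → ℝ) : ℝ → ℝ :=
  fun x => Real.exp (-(d * ∫ y in (-x)..lam, (x + y) ^ (d - 1) * f y))

/-- Membership in the class 𝔉 of non-increasing `[0,1]`-valued functions on `[-λ, λ]`. -/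
def memF (lam : ℝ) (f : ℝ → ℝ) : Prop :=
  AntitoneOn f (Icc (-lam) lam) ∧ ∀ x ∈ Icc (-lam) lam, f x ∈ Icc (0 : ℝ) 1

lemma cavity_strict (d lam : ℝ) (hd : 1 < d) (f g : ℝ → ℝ) (hf : Continuous f)
    (hg : Continuous g) (fpos : ∀ x, 0 < f x)
    (hfix : ∀ x ∈ Icc (-lam) lam, T d lam f x = f x)
    (hgix : ∀ x ∈ Icc (-lam) lam, T d lam g x = g x)
    (x s : ℝ) (hx : x ∈ Icc (-lam) lam) (hs : s ∈ Icc (-lam) lam) (hxs : x < s)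
    (h : ∀ z ∈ Icc (-lam) lam, z + (s - x) < lam → g (z + (s - x)) ≤ f z) : f s < g x := by
  rw [← hfix s hs, ← hgix x hx]
  obtain ⟨hx1, hx2⟩ := hx
  obtain ⟨hs1, hs2⟩ := hs
  unfold T
  rw [Real.exp_lt_exp, neg_lt_neg_iff]
  refine mul_lt_mul_of_pos_left ?_ (by linarith)
  have hc : ∀ a : ℝ, Continuous fun y : ℝ => (a + y) ^ (d - 1) := fun a =>
    (continuous_const.add continuous_id).rpow_const (fun _ => Or.inr (by linarith))
  have e1 : ∫ y in (-x)..lam, (x + y) ^ (d - 1) * g y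
      = ∫ z in (-s)..(lam - (s - x)), (s + z) ^ (d - 1) * g (z + (s - x)) := by
    have := intervalIntegral.integral_comp_add_right (a := -s) (b := lam - (s - x))
      (fun y => (x + y) ^ (d - 1) * g y) (s - x)
    rw [show -s + (s - x) = -x by ring, show lam - (s - x) + (s - x) = lam by ring] at this
    rw [← this]
    congr 1
    ext z
    rw [show x + (z + (s - x)) = s + z by ring]
  have cf : Continuous fun y => (s + y) ^ (d - 1) * f y := (hc s).mul hf
  have cg : Continuous fun z => (s + z) ^ (d - 1) * g (z + (s - x)) :=
    (hc s).mul (hg.comp (continuous_id.add continuous_const))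
  have e2 := intervalIntegral.integral_add_adjacent_intervals
    (cf.intervalIntegrable (μ := volume) (-s) (lam - (s - x)))
    (cf.intervalIntegrable (μ := volume) (lam - (s - x)) lam)
  rw [e1, ← e2]
  have i1 : ∫ z in (-s)..(lam - (s - x)), (s + z) ^ (d - 1) * g (z + (s - x))
      ≤ ∫ y in (-s)..(lam - (s - x)), (s + y) ^ (d - 1) * f y := by
    refine intervalIntegral.integral_mono_on_of_le_Ioo (by linarith)
      (cg.intervalIntegrable _ _) (cf.intervalIntegrable _ _) ?_
    rintro z ⟨hz1, hz2⟩
    exact mul_le_mul_of_nonneg_left (h z ⟨by linarith, by linarith⟩ (by linarith))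
      (Real.rpow_nonneg (by linarith) _)
  have i2 : 0 < ∫ y in (lam - (s - x))..lam, (s + y) ^ (d - 1) * f y := by
    refine intervalIntegral.intervalIntegral_pos_of_pos_on (cf.intervalIntegrable _ _) ?_
      (by linarith)
    rintro z ⟨hz1, hz2⟩
    exact mul_pos (Real.rpow_pos_of_pos (by linarith) _) (fpos z)
  linarith

lemma cavity_cont (d lam : ℝ) (hd : 1 < d) (hlam : 0 < lam) (f g : ℝ → ℝ) (hf : Continuous f)
    (hg : Continuous g) (fpos : ∀ x, 0 < f x) (gpos : ∀ x, 0 < g x)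
    (hfix : ∀ x ∈ Icc (-lam) lam, T d lam f x = f x)
    (hgix : ∀ x ∈ Icc (-lam) lam, T d lam g x = g x) :
    ∀ x ∈ Icc (-lam) lam, f x = g x := by
  let B : Set (ℝ × ℝ) := (Icc (-lam) lam ×ˢ Icc (-lam) lam) ∩
    {p | p.1 ≤ p.2 ∧ (g p.1 ≤ f p.2 ∨ f p.1 ≤ g p.2)}
  have hB : IsCompact B := by
    refine (isCompact_Icc.prod isCompact_Icc).inter_right ?_
    refine (isClosed_le continuous_fst continuous_snd).inter (IsClosed.union ?_ ?_)
    · exact isClosed_le (hg.comp continuous_fst) (hf.comp continuous_snd)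
    · exact isClosed_le (hf.comp continuous_fst) (hg.comp continuous_snd)
  have hne : B.Nonempty :=
    ⟨(-lam, -lam), ⟨⟨⟨le_rfl, by linarith⟩, ⟨le_rfl, by linarith⟩⟩, le_rfl, le_total _ _⟩⟩
  obtain ⟨⟨x, s⟩, ⟨⟨hx, hs⟩, hxs, hor⟩, hmax⟩ := hB.exists_isMaxOn hne
    (f := fun p => p.2 - p.1) (by fun_prop)
  simp only at hx hs hxs hor
  -- anything at larger distance is good
  have good : ∀ a ∈ Icc (-lam) lam, ∀ b ∈ Icc (-lam) lam, s - x < b - a →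
      f b < g a ∧ g b < f a := by
    intro a ha b hb hab
    by_contra hcon
    have hm : (a, b) ∈ B := by
      refine ⟨⟨ha, hb⟩, ?_, ?_⟩
      · show a ≤ b
        linarith
      · show g a ≤ f b ∨ f a ≤ g b
        by_contra hh
        push Not at hh
        exact hcon hh
    have := hmax hm
    simp only [mem_ofPred_eq] at this
    linarith
  have lim : ∀ u v : ℝ → ℝ, Continuous u →
      (∀ a ∈ Icc (-lam) lam, ∀ b ∈ Icc (-lam) lam, s - x < b - a → u b < v a) →
      ∀ z ∈ Icc (-lam) lam, z + (s - x) < lam → u (z + (s - x)) ≤ v z := by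
    intro u v hu huv z hz hzl
    have ht : Filter.Tendsto u (nhdsWithin (z + (s - x)) (Ioi (z + (s - x))))
        (nhds (u (z + (s - x)))) := hu.continuousWithinAt
    refine le_of_tendsto ht ?_
    filter_upwards [Ioo_mem_nhdsGT hzl] with b hb
    exact (huv z hz b ⟨by linarith [hz.1, hb.1], hb.2.le⟩ (by linarith [hb.1])).le
  have lf := lim f g hf (fun a ha b hb hab => (good a ha b hb hab).1)
  have lg := lim g f hg (fun a ha b hb hab => (good a ha b hb hab).2)
  rcases hxs.lt_or_eq with hlt | heq
  · exfalso
    rcases hor with h | h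
    · exact absurd h (not_le.2 (cavity_strict d lam hd f g hf hg fpos hfix hgix x s hx hs hlt lg))
    · exact absurd h (not_le.2 (cavity_strict d lam hd g f hg hf gpos hgix hfix x s hx hs hlt lf))
  · subst heq
    simp only [sub_self, add_zero] at lf lg
    have hE : EqOn f g (closure (Ioo (-lam) lam)) := by
      refine EqOn.closure (fun z hz => ?_) hf hg
      exact le_antisymm (lf z ⟨hz.1.le, hz.2.le⟩ hz.2) (lg z ⟨hz.1.le, hz.2.le⟩ hz.2)
    rw [closure_Ioo (by linarith)] at hE
    exact hE

lemma cavity_ext (d lam : ℝ) (hd : 1 < d) (hlam : 0 < lam) (f : ℝ → ℝ) (hf : memF lam f)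
    (hfix : ∀ x ∈ Icc (-lam) lam, T d lam f x = f x) :
    ∃ u : ℝ → ℝ, Continuous u ∧ (∀ x, 0 < u x) ∧ (∀ x ∈ Icc (-lam) lam, u x = f x) ∧
      ∀ x ∈ Icc (-lam) lam, T d lam u x = u x := by
  have hint : IntervalIntegrable f volume (-lam) lam := by
    apply AntitoneOn.intervalIntegrable
    rw [uIcc_of_le (by linarith)]
    exact hf.1
  have hk : Continuous fun p : ℝ × ℝ => (max (p.1 + p.2) 0) ^ (d - 1) :=
    ((continuous_fst.add continuous_snd).max continuous_const).rpow_const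
      (fun _ => Or.inr (by linarith))
  have hJ : Continuous fun x : ℝ => ∫ y in (-lam)..lam, (max (x + y) 0) ^ (d - 1) * f y := by
    rw [continuous_iff_continuousAt]
    intro x0
    refine intervalIntegral.continuousAt_of_dominated_interval
      (bound := fun _ => (|x0| + 1 + lam) ^ (d - 1)) ?_ ?_ ?_ ?_
    · refine Filter.Eventually.of_forall fun x => ?_
      rw [uIoc_of_le (by linarith)]
      refine AEStronglyMeasurable.mul ?_ hint.1.aestronglyMeasurable
      exact (hk.comp (Continuous.prodMk_right x)).aestronglyMeasurable
    · filter_upwards [Metric.ball_mem_nhds x0 one_pos] with x hx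
      refine Filter.Eventually.of_forall fun y hy => ?_
      rw [uIoc_of_le (by linarith)] at hy
      have hfy := hf.2 y ⟨hy.1.le, hy.2⟩
      have hxx : x ≤ |x0| + 1 := by
        rw [Metric.mem_ball, Real.dist_eq] at hx
        linarith [(abs_lt.1 hx).2, le_abs_self x0]
      have h0 : 0 ≤ (max (x + y) 0) ^ (d - 1) := Real.rpow_nonneg (le_max_right _ _) _
      rw [Real.norm_eq_abs, abs_of_nonneg (mul_nonneg h0 hfy.1)]
      refine (mul_le_of_le_one_right h0 hfy.2).trans ?_
      refine Real.rpow_le_rpow (le_max_right _ _) (max_le ?_ ?_) (by linarith)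
      · linarith [hy.2]
      · positivity
    · exact intervalIntegrable_const
    · refine Filter.Eventually.of_forall fun y _ => ?_
      exact ((hk.comp (Continuous.prodMk_left y)).mul continuous_const).continuousAt
  have hJe : ∀ x ∈ Icc (-lam) lam, ∫ y in (-lam)..lam, (max (x + y) 0) ^ (d - 1) * f y
      = ∫ y in (-x)..lam, (x + y) ^ (d - 1) * f y := by
    rintro x ⟨hx1, hx2⟩
    have hI : IntervalIntegrable (fun y => (max (x + y) 0) ^ (d - 1) * f y) volume (-lam) lam :=
      hint.continuousOn_mul (hk.comp (Continuous.prodMk_right x)).continuousOn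
    have hm : -x ∈ uIcc (-lam) lam := by
      rw [uIcc_of_le (by linarith)]
      exact ⟨by linarith, by linarith⟩
    rw [← intervalIntegral.integral_add_adjacent_intervals
      (hI.mono_set (uIcc_subset_uIcc left_mem_uIcc hm))
      (hI.mono_set (uIcc_subset_uIcc hm right_mem_uIcc))]
    have z1 : ∫ y in (-lam)..(-x), (max (x + y) 0) ^ (d - 1) * f y = 0 := by
      rw [intervalIntegral.integral_congr (g := fun _ => (0 : ℝ))]
      · simp
      · intro y hy
        rw [uIcc_of_le (by linarith)] at hy
        simp only
        rw [max_eq_right (by linarith [hy.2]), Real.zero_rpow (by linarith), zero_mul]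
    rw [z1, zero_add]
    refine intervalIntegral.integral_congr fun y hy => ?_
    rw [uIcc_of_le (by linarith)] at hy
    rw [max_eq_left (by linarith [hy.1])]
  have hu : ∀ x ∈ Icc (-lam) lam,
      Real.exp (-(d * ∫ y in (-lam)..lam, (max (x + y) 0) ^ (d - 1) * f y)) = f x := by
    intro x hx
    rw [hJe x hx]
    exact hfix x hx
  refine ⟨fun x => Real.exp (-(d * ∫ y in (-lam)..lam, (max (x + y) 0) ^ (d - 1) * f y)),
    Real.continuous_exp.comp (continuous_const.mul hJ).neg, fun x => Real.exp_pos _, hu, ?_⟩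
  intro x hx
  refine Eq.trans ?_ (hu x hx).symm
  rw [← hfix x hx]
  unfold T
  congr 3
  refine intervalIntegral.integral_congr fun y hy => ?_
  rw [uIcc_of_le (by linarith [hx.1])] at hy
  beta_reduce
  rw [hu y ⟨by linarith [hx.2, hy.1], hy.2⟩]

/-- uniqueness of the fixed point of the truncated cavity operator. -/
theorem truncated_cavity_unique_fixedPoint (d lam : ℝ) (hd : 1 < d) (hlam : 0 < lam)
    (f g : ℝ → ℝ) (hf : memF lam f) (hg : memF lam g)
    (hfix : ∀ x ∈ Icc (-lam) lam, T d lam f x = f x)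
    (hgix : ∀ x ∈ Icc (-lam) lam, T d lam g x = g x) :
    ∀ x ∈ Icc (-lam) lam, f x = g x := by
  obtain ⟨u, cu, pu, eu, fu⟩ := cavity_ext d lam hd hlam f hf hfix
  obtain ⟨v, cv, pv, ev, fv⟩ := cavity_ext d lam hd hlam g hg hgix
  intro x hx
  rw [← eu x hx, ← ev x hx]
  exact cavity_cont d lam hd hlam u v cu cv pu pv fu fv x hx
end

section
/- For d > 1 and 0 < λ < ∞, the unique fixed point f_λ of T is globally attractive: sup over x ∈ [-λ, λ] and over f ∈ 𝔉 of |T^n f(x) - f_λ(x)| tends to 0 as n → ∞. -/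
open MeasureTheory Set

open Filter Topology

namespace Cav

/-- Integrable functions with values in `[0,1]` on `[-λ, λ]`. -/
def Adm (lam : ℝ) (f : ℝ → ℝ) : Prop :=
  IntervalIntegrable f volume (-lam) lam ∧ ∀ x ∈ Icc (-lam) lam, f x ∈ Icc (0 : ℝ) 1

/-- Linear part. -/
noncomputable def L (k : ℝ → ℝ) (lam : ℝ) (f : ℝ → ℝ) (x : ℝ) : ℝ :=
  ∫ y in (-lam)..lam, k (x + y) * f y

/-- Abstract cavity operator, defined on the whole line. -/
noncomputable def S (k : ℝ → ℝ) (lam : ℝ) (f : ℝ → ℝ) (x : ℝ) : ℝ :=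
  Real.exp (-(L k lam f x))

/-- Properties of the kernel. -/
structure Ker (k : ℝ → ℝ) : Prop where
  cont : Continuous k
  mono : Monotone k
  nonneg : ∀ u, 0 ≤ k u
  zero : ∀ u ≤ 0, k u = 0
  pos : ∀ u > 0, 0 < k u

variable {k : ℝ → ℝ} {lam : ℝ}

lemma integ (hk : Ker k) {f : ℝ → ℝ} (hf : Adm lam f) (x : ℝ) :
    IntervalIntegrable (fun y => k (x + y) * f y) volume (-lam) lam := by
  have := hk.cont
  exact hf.1.continuousOn_mul (by fun_prop)

lemma L_nonneg (hk : Ker k) (hl : 0 < lam) {f : ℝ → ℝ} (hf : Adm lam f) (x : ℝ) :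
    0 ≤ L k lam f x :=
  intervalIntegral.integral_nonneg (by linarith) fun y hy => mul_nonneg (hk.nonneg _) (hf.2 y hy).1

lemma L_mono (hk : Ker k) (hl : 0 < lam) {f : ℝ → ℝ} (hf : Adm lam f) :
    Monotone (L k lam f) := fun x x' h =>
  intervalIntegral.integral_mono_on (by linarith) (integ hk hf x) (integ hk hf x')
    fun y hy => mul_le_mul_of_nonneg_right (hk.mono (by linarith)) (hf.2 y hy).1

lemma L_le (hk : Ker k) (hl : 0 < lam) {f g : ℝ → ℝ} (hf : Adm lam f) (hg : Adm lam g)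
    (h : ∀ x ∈ Icc (-lam) lam, f x ≤ g x) (x : ℝ) : L k lam f x ≤ L k lam g x :=
  intervalIntegral.integral_mono_on (by linarith) (integ hk hf x) (integ hk hg x)
    fun y hy => mul_le_mul_of_nonneg_left (h y hy) (hk.nonneg _)

lemma L_cont (hk : Ker k) (hl : 0 < lam) {f : ℝ → ℝ} (hf : Adm lam f) :
    Continuous (L k lam f) := by
  rw [continuous_iff_continuousAt]
  intro x0
  apply intervalIntegral.continuousAt_of_dominated_interval
    (bound := fun _ => k (x0 + 1 + lam))
  · filter_upwards with x using (intervalIntegrable_iff.1 (integ hk hf x)).aestronglyMeasurable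
  · filter_upwards [Iio_mem_nhds (show x0 < x0 + 1 by linarith)] with x hx
    filter_upwards with y hy
    rw [uIoc_of_le (by linarith)] at hy
    have h := hf.2 y ⟨hy.1.le, hy.2⟩
    rw [Real.norm_of_nonneg (mul_nonneg (hk.nonneg _) h.1)]
    have h1 : k (x + y) ≤ k (x0 + 1 + lam) := hk.mono (by
      have := hy.2; have : x < x0 + 1 := hx; linarith)
    calc k (x + y) * f y ≤ k (x + y) * 1 := mul_le_mul_of_nonneg_left h.2 (hk.nonneg _)
      _ ≤ _ := by linarith
  · simp
  · filter_upwards with y hy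
    have := hk.cont
    fun_prop

lemma L_zero (hk : Ker k) (hl : 0 < lam) (f : ℝ → ℝ) {x : ℝ} (hx : x ≤ -lam) :
    L k lam f x = 0 := by
  unfold L
  rw [intervalIntegral.integral_congr (g := fun _ => 0)]
  · simp
  · intro y hy
    rw [uIcc_of_le (by linarith)] at hy
    have := hy.2
    simp [hk.zero (x + y) (by linarith)]

lemma S_cont (hk : Ker k) (hl : 0 < lam) {f : ℝ → ℝ} (hf : Adm lam f) :
    Continuous (S k lam f) := by
  have := L_cont hk hl hf
  unfold S
  fun_prop

lemma S_pos (f : ℝ → ℝ) (x : ℝ) : 0 < S k lam f x := Real.exp_pos _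

lemma S_le_one (hk : Ker k) (hl : 0 < lam) {f : ℝ → ℝ} (hf : Adm lam f) (x : ℝ) :
    S k lam f x ≤ 1 := by
  have := L_nonneg hk hl hf x
  unfold S
  rw [Real.exp_le_one_iff]
  linarith

lemma S_adm (hk : Ker k) (hl : 0 < lam) {f : ℝ → ℝ} (hf : Adm lam f) :
    Adm lam (S k lam f) :=
  ⟨(S_cont hk hl hf).intervalIntegrable _ _, fun x _ => ⟨(S_pos f x).le, S_le_one hk hl hf x⟩⟩

lemma S_anti (hk : Ker k) (hl : 0 < lam) {f : ℝ → ℝ} (hf : Adm lam f) :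
    Antitone (S k lam f) := fun x x' h => by
  have := L_mono hk hl hf h
  unfold S
  rw [Real.exp_le_exp]
  linarith

lemma S_le (hk : Ker k) (hl : 0 < lam) {f g : ℝ → ℝ} (hf : Adm lam f) (hg : Adm lam g)
    (h : ∀ x ∈ Icc (-lam) lam, f x ≤ g x) (x : ℝ) : S k lam g x ≤ S k lam f x := by
  have := L_le hk hl hf hg h x
  unfold S
  rw [Real.exp_le_exp]
  linarith

lemma S_one (hk : Ker k) (hl : 0 < lam) (f : ℝ → ℝ) {x : ℝ} (hx : x ≤ -lam) :
    S k lam f x = 1 := by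
  simp [S, L_zero hk hl f hx]

/-- Exchange identity. -/
lemma swap_id (hk : Ker k) {f g : ℝ → ℝ} (hf : Continuous f) (hg : Continuous g) (h : ℝ) :
    ∫ x in (-lam)..lam, f x * (L k lam g x - L k lam g (x - h)) =
    ∫ x in (-lam)..lam, g x * (L k lam f x - L k lam f (x - h)) := by
  have hc := hk.cont
  have key : ∀ f g : ℝ → ℝ, Continuous f → Continuous g → ∀ x,
      f x * (L k lam g x - L k lam g (x - h)) =
        ∫ y in (-lam)..lam, f x * ((k (x + y) - k (x + y - h)) * g y) := by
    intro f g hf hg x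
    unfold L
    rw [← intervalIntegral.integral_sub, ← intervalIntegral.integral_const_mul]
    · congr 1; ext y
      rw [show x - h + y = x + y - h by ring]; ring
    · apply Continuous.intervalIntegrable; fun_prop
    · apply Continuous.intervalIntegrable; fun_prop
  simp_rw [key f g hf hg, key g f hg hf]
  rw [intervalIntegral_intervalIntegral_swap]
  · congr 1; ext x; congr 1; ext y
    rw [add_comm y x]; ring
  · have : Continuous (Function.uncurry fun x y => f x * ((k (x + y) - k (x + y - h)) * g y)) := by
      unfold Function.uncurry
      fun_prop
    exact ((this.continuousOn.integrableOn_compact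
      (isCompact_uIcc.prod isCompact_uIcc)).mono_set
        (prod_mono uIoc_subset_uIcc uIoc_subset_uIcc))

lemma key_ineq (hk : Ker k) (hl : 0 < lam) {f g : ℝ → ℝ} (hf : Adm lam f) (hg : Adm lam g)
    (hfg : f = S k lam g) (hgf : g = S k lam f) : g lam ≤ f lam := by
  have cf : Continuous f := hfg ▸ S_cont hk hl hg
  have cg : Continuous g := hgf ▸ S_cont hk hl hf
  have af : Antitone f := hfg ▸ S_anti hk hl hg
  have ag : Antitone g := hgf ▸ S_anti hk hl hf
  have cLf := L_cont hk hl hf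
  have cLg := L_cont hk hl hg
  have ii : ∀ F : ℝ → ℝ, Continuous F → ∀ a b, IntervalIntegrable F volume a b :=
    fun F hF a b => hF.intervalIntegrable a b
  have shift : ∀ F : ℝ → ℝ, Continuous F → ∀ h, ∫ x in (-lam)..lam, (F (x - h) - F x) =
      (∫ x in (-lam - h)..(-lam), F x) - ∫ x in (lam - h)..lam, F x := by
    intro F hF h
    rw [intervalIntegral.integral_sub (ii _ (by fun_prop) _ _) (ii _ hF _ _),
      intervalIntegral.integral_comp_sub_right (fun x => F x) h]
    have h1 := intervalIntegral.integral_add_adjacent_intervals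
      (ii F hF (-lam - h) (-lam)) (ii F hF (-lam) (lam - h))
    have h2 := intervalIntegral.integral_add_adjacent_intervals
      (ii F hF (-lam) (lam - h)) (ii F hF (lam - h) lam)
    linarith
  -- main estimate
  have main : ∀ η > 0, ∃ δ > 0, ∀ h, 0 < h → h < δ →
      1 - f (lam - h) ≤ Real.exp η * (1 - g lam) := by
    intro η hη
    have uc := isCompact_Icc.uniformContinuousOn_of_continuous
      (cLg.continuousOn (s := Icc (-lam - 1) lam))
    rw [Metric.uniformContinuousOn_iff] at uc
    obtain ⟨δ, hδ, H⟩ := uc η hη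
    refine ⟨min δ 1, lt_min hδ one_pos, fun h h0 h1 => ?_⟩
    have hhδ : h < δ := h1.trans_le (min_le_left _ _)
    have hh1 : h < 1 := h1.trans_le (min_le_right _ _)
    have hid := swap_id (lam := lam) hk cf cg h
    -- upper
    have up : ∫ x in (-lam)..lam, g x * (L k lam f x - L k lam f (x - h)) ≤ h * (1 - g lam) := by
      have e1 : ∫ x in (-lam)..lam, g x * (L k lam f x - L k lam f (x - h)) ≤
          ∫ x in (-lam)..lam, (g (x - h) - g x) := by
        apply intervalIntegral.integral_mono_on (by linarith) (ii _ (by fun_prop) _ _)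
          (ii _ (by fun_prop) _ _)
        intro x hx
        have e : g (x - h) = g x * Real.exp (L k lam f x - L k lam f (x - h)) := by
          rw [hgf]; unfold S; rw [← Real.exp_add]; congr 1; ring
        have p : 0 < g x := by rw [hgf]; exact S_pos _ _
        have := Real.add_one_le_exp (L k lam f x - L k lam f (x - h))
        rw [e]; nlinarith
      rw [shift g cg] at e1
      have e2 : ∫ x in (-lam - h)..(-lam), g x ≤ ∫ x in (-lam - h)..(-lam), (1 : ℝ) :=
        intervalIntegral.integral_mono_on (by linarith) (ii _ cg _ _) (by simp)
          fun x _ => by rw [hgf]; exact S_le_one hk hl hf x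
      have e3 : ∫ x in (lam - h)..lam, g lam ≤ ∫ x in (lam - h)..lam, g x :=
        intervalIntegral.integral_mono_on (by linarith) (by simp) (ii _ cg _ _)
          fun x hx => ag hx.2
      simp at e2 e3
      linarith
    have lo : h * (1 - f (lam - h)) ≤ Real.exp η *
        ∫ x in (-lam)..lam, f x * (L k lam g x - L k lam g (x - h)) := by
      have e1 : ∫ x in (-lam)..lam, (f (x - h) - f x) ≤ 
          ∫ x in (-lam)..lam, Real.exp η * (f x * (L k lam g x - L k lam g (x - h))) := by
        apply intervalIntegral.integral_mono_on (by linarith) (ii _ (by fun_prop) _ _)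
          (ii _ (by fun_prop) _ _)
        intro x hx
        have e : f (x - h) = f x * Real.exp (L k lam g x - L k lam g (x - h)) := by
          rw [hfg]; unfold S; rw [← Real.exp_add]; congr 1; ring
        have p : 0 < f x := by rw [hfg]; exact S_pos _ _
        have s0 : 0 ≤ L k lam g x - L k lam g (x - h) := by
          have := L_mono hk hl hg (show x - h ≤ x by linarith)
          linarith
        have s1 : L k lam g x - L k lam g (x - h) ≤ η := by
          have := H x ⟨by linarith [hx.1], hx.2⟩ (x - h)
            ⟨by linarith [hx.1], by linarith [hx.2]⟩ (by
              rw [Real.dist_eq, show x - (x - h) = h by ring, abs_of_pos h0]; exact hhδ)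
          rw [Real.dist_eq] at this
          exact (le_abs_self _).trans this.le
        rw [e]
        set s := L k lam g x - L k lam g (x - h)
        have q1 : Real.exp s - 1 ≤ s * Real.exp s := by
          have h1 := Real.add_one_le_exp (-s)
          have h2 : Real.exp (-s) * Real.exp s = 1 := by rw [← Real.exp_add]; simp
          nlinarith [Real.exp_pos s]
        have q2 : s * Real.exp s ≤ s * Real.exp η :=
          mul_le_mul_of_nonneg_left (Real.exp_le_exp.2 s1) s0
        nlinarith
      rw [shift f cf, intervalIntegral.integral_const_mul] at e1
      have e2 : ∫ x in (-lam - h)..(-lam), (1 : ℝ) ≤ ∫ x in (-lam - h)..(-lam), f x :=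
        intervalIntegral.integral_mono_on (by linarith) (by simp) (ii _ cf _ _)
          fun x hx => by rw [hfg, S_one hk hl g hx.2]
      have e3 : ∫ x in (lam - h)..lam, f x ≤ ∫ x in (lam - h)..lam, f (lam - h) :=
        intervalIntegral.integral_mono_on (by linarith) (ii _ cf _ _) (by simp)
          fun x hx => af hx.1
      simp at e2 e3
      linarith
    rw [hid] at lo
    have := lo.trans (mul_le_mul_of_nonneg_left up (Real.exp_pos η).le)
    have : h * (1 - f (lam - h)) ≤ h * (Real.exp η * (1 - g lam)) := by linarith
    exact le_of_mul_le_mul_left this h0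
  have main2 : ∀ η > 0, 1 - f lam ≤ Real.exp η * (1 - g lam) := by
    intro η hη
    obtain ⟨δ, hδ, H⟩ := main η hη
    have t : Tendsto (fun h => 1 - f (lam - h)) (𝓝[>] 0) (𝓝 (1 - f lam)) := by
      have c : Continuous (fun h => 1 - f (lam - h)) := by fun_prop
      have := c.tendsto 0
      simp only [sub_zero] at this
      exact this.mono_left nhdsWithin_le_nhds
    refine le_of_tendsto t ?_
    filter_upwards [Ioo_mem_nhdsGT hδ] with h hh using H h hh.1 hh.2
  have t : Tendsto (fun η => Real.exp η * (1 - g lam)) (𝓝[>] 0) (𝓝 (1 - g lam)) := by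
    have c : Continuous (fun η => Real.exp η * (1 - g lam)) := by fun_prop
    have := c.tendsto 0
    simp only [Real.exp_zero, one_mul] at this
    exact this.mono_left nhdsWithin_le_nhds
  have : 1 - f lam ≤ 1 - g lam := by
    refine ge_of_tendsto t ?_
    filter_upwards [self_mem_nhdsWithin] with η hη using main2 η hη
  linarith

lemma two_cycle (hk : Ker k) (hl : 0 < lam) {f g : ℝ → ℝ} (hf : Adm lam f) (hg : Adm lam g)
    (hfg : f = S k lam g) (hgf : g = S k lam f) (hle : ∀ x, f x ≤ g x) :
    ∀ x ∈ Icc (-lam) lam, f x = g x := by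
  intro c hcc
  have cf : Continuous f := hfg ▸ S_cont hk hl hg
  have cg : Continuous g := hgf ▸ S_cont hk hl hf
  have hc := hk.cont
  have e : f lam = g lam := le_antisymm (hle _) (key_ineq hk hl hf hg hfg hgf)
  have e' : L k lam g lam = L k lam f lam := by
    rw [congrFun hfg lam, congrFun hgf lam] at e
    have := Real.exp_injective e
    linarith
  rcases eq_or_lt_of_le hcc.1 with h1 | h1
  · rw [hfg, hgf, S_one hk hl _ h1.ge, S_one hk hl _ h1.ge]
  by_contra hne
  have hlt : f c < g c := lt_of_le_of_ne (hle c) hne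
  have : 0 < ∫ y in (-lam)..lam, k (lam + y) * (g y - f y) := by
    apply intervalIntegral.integral_pos (by linarith) (by fun_prop)
    · intro x _
      exact mul_nonneg (hk.nonneg _) (by linarith [hle x])
    · exact ⟨c, hcc, mul_pos (hk.pos _ (by linarith)) (by linarith)⟩
  simp_rw [mul_sub] at this
  rw [intervalIntegral.integral_sub (integ hk hg lam) (integ hk hf lam)] at this
  unfold L at e'
  linarith

lemma S_tendsto (hk : Ker k) (hl : 0 < lam) {v : ℕ → ℝ → ℝ} {w : ℝ → ℝ}
    (hv : ∀ n, Adm lam (v n))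
    (h : ∀ x, Tendsto (fun n => v n x) atTop (𝓝 (w x))) (x : ℝ) :
    Tendsto (fun n => S k lam (v n) x) atTop (𝓝 (S k lam w x)) := by
  refine (Real.continuous_exp.tendsto _).comp (Tendsto.neg ?_)
  apply intervalIntegral.tendsto_integral_filter_of_dominated_convergence
    (bound := fun _ => k (x + lam))
  · filter_upwards with n using (intervalIntegrable_iff.1 (integ hk (hv n) x)).aestronglyMeasurable
  · filter_upwards with n
    filter_upwards with y hy
    rw [uIoc_of_le (by linarith)] at hy
    have h := (hv n).2 y ⟨hy.1.le, hy.2⟩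
    rw [Real.norm_of_nonneg (mul_nonneg (hk.nonneg _) h.1)]
    have h1 : k (x + y) ≤ k (x + lam) := hk.mono (by linarith [hy.2])
    calc k (x + y) * v n y ≤ k (x + y) * 1 := mul_le_mul_of_nonneg_left h.2 (hk.nonneg _)
      _ ≤ _ := by linarith
  · simp
  · filter_upwards with y hy
    exact (h y).const_mul _

/-- Iterates from zero. -/
noncomputable def u (k : ℝ → ℝ) (lam : ℝ) (n : ℕ) : ℝ → ℝ := (S k lam)^[n] (fun _ => 0)

lemma u_zero : u k lam 0 = fun _ => 0 := rfl

lemma u_succ (n : ℕ) : u k lam (n + 1) = S k lam (u k lam n) :=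
  Function.iterate_succ_apply' _ _ _

lemma iter_adm (hk : Ker k) (hl : 0 < lam) {f : ℝ → ℝ} (hf : Adm lam f) (n : ℕ) :
    Adm lam ((S k lam)^[n] f) := by
  induction n with
  | zero => exact hf
  | succ n ih => rw [Function.iterate_succ_apply']; exact S_adm hk hl ih

lemma zero_adm : Adm lam (fun _ => 0) := ⟨by simp, fun x _ => by simp⟩

lemma u_adm (hk : Ker k) (hl : 0 < lam) (n : ℕ) : Adm lam (u k lam n) :=
  iter_adm hk hl zero_adm n

lemma u_mem (hk : Ker k) (hl : 0 < lam) (n : ℕ) (x : ℝ) : 0 ≤ u k lam n x ∧ u k lam n x ≤ 1 := by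
  cases n with
  | zero => simp [u_zero]
  | succ n =>
    rw [u_succ]
    exact ⟨(S_pos _ _).le, S_le_one hk hl (u_adm hk hl n) x⟩

lemma u_cont (hk : Ker k) (hl : 0 < lam) (n : ℕ) : Continuous (u k lam n) := by
  cases n with
  | zero => rw [u_zero]; exact continuous_const
  | succ n => rw [u_succ]; exact S_cont hk hl (u_adm hk hl n)

lemma u_anti_step (hk : Ker k) (hl : 0 < lam) {m n : ℕ} (h : ∀ x, u k lam m x ≤ u k lam n x)
    (x : ℝ) : u k lam (n + 1) x ≤ u k lam (m + 1) x := by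
  rw [u_succ, u_succ]
  exact S_le hk hl (u_adm hk hl m) (u_adm hk hl n) (fun x _ => h x) x

lemma u_even (hk : Ker k) (hl : 0 < lam) (n : ℕ) :
    ∀ x, u k lam (2 * n) x ≤ u k lam (2 * n + 2) x := by
  induction n with
  | zero => intro x; exact (u_mem hk hl 2 x).1
  | succ n ih => exact u_anti_step hk hl (u_anti_step hk hl ih)

lemma u_odd (hk : Ker k) (hl : 0 < lam) (n : ℕ) :
    ∀ x, u k lam (2 * n + 3) x ≤ u k lam (2 * n + 1) x :=
  u_anti_step hk hl (u_even hk hl n)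

lemma u_eo (hk : Ker k) (hl : 0 < lam) (n : ℕ) :
    ∀ x, u k lam (2 * n) x ≤ u k lam (2 * n + 1) x := by
  induction n with
  | zero => intro x; exact (u_mem hk hl 1 x).1
  | succ n ih => exact u_anti_step hk hl (u_anti_step hk hl ih)

lemma sandwich (hk : Ker k) (hl : 0 < lam) {F : ℝ → ℝ} (hF : Adm lam F) (n : ℕ) :
    (∀ x ∈ Icc (-lam) lam, u k lam (2 * n) x ≤ (S k lam)^[2 * n] F x ∧
      (S k lam)^[2 * n] F x ≤ u k lam (2 * n + 1) x) ∧
    (∀ x ∈ Icc (-lam) lam, u k lam (2 * n + 2) x ≤ (S k lam)^[2 * n + 1] F x ∧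
      (S k lam)^[2 * n + 1] F x ≤ u k lam (2 * n + 1) x) := by
  have A : ∀ m, Adm lam ((S k lam)^[m] F) := iter_adm hk hl hF
  have U : ∀ m, Adm lam (u k lam m) := u_adm hk hl
  have up : ∀ m n, (∀ x ∈ Icc (-lam) lam, u k lam m x ≤ (S k lam)^[n] F x) →
      ∀ x, (S k lam)^[n + 1] F x ≤ u k lam (m + 1) x := by
    intro m n h x
    rw [Function.iterate_succ_apply', u_succ]
    exact S_le hk hl (U m) (A n) h x
  have dn : ∀ m n, (∀ x ∈ Icc (-lam) lam, (S k lam)^[n] F x ≤ u k lam m x) →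
      ∀ x, u k lam (m + 1) x ≤ (S k lam)^[n + 1] F x := by
    intro m n h x
    rw [Function.iterate_succ_apply', u_succ]
    exact S_le hk hl (A n) (U m) h x
  have step : ∀ n, (∀ x ∈ Icc (-lam) lam, u k lam (2 * n) x ≤ (S k lam)^[2 * n] F x ∧
      (S k lam)^[2 * n] F x ≤ u k lam (2 * n + 1) x) →
    (∀ x ∈ Icc (-lam) lam, u k lam (2 * n + 2) x ≤ (S k lam)^[2 * n + 1] F x ∧
      (S k lam)^[2 * n + 1] F x ≤ u k lam (2 * n + 1) x) := fun n h x _ =>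
    ⟨dn (2 * n + 1) (2 * n) (fun x hx => (h x hx).2) x, up (2 * n) (2 * n) (fun x hx => (h x hx).1) x⟩
  suffices H : ∀ x ∈ Icc (-lam) lam, u k lam (2 * n) x ≤ (S k lam)^[2 * n] F x ∧
      (S k lam)^[2 * n] F x ≤ u k lam (2 * n + 1) x from ⟨H, step n H⟩
  induction n with
  | zero =>
    intro x hx
    have e : u k lam (2 * 0 + 1) x = 1 := by
      simp [u, S, L]
    rw [e]
    exact hF.2 x hx
  | succ n ih =>
    have h := step n ih
    intro x hx
    exact ⟨dn (2 * n + 1) (2 * n + 1) (fun x hx => (h x hx).2) x,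
      up (2 * n + 2) (2 * n + 1) (fun x hx => (h x hx).1) x⟩

lemma limit (hk : Ker k) (hl : 0 < lam) : ∃ f : ℝ → ℝ,
    TendstoUniformlyOn (fun n => u k lam (2 * n)) f atTop (Icc (-lam) lam) ∧
    TendstoUniformlyOn (fun n => u k lam (2 * n + 1)) f atTop (Icc (-lam) lam) := by
  have me : ∀ x, Monotone (fun n => u k lam (2 * n) x) := fun x =>
    monotone_nat_of_le_succ fun n => u_even hk hl n x
  have mo : ∀ x, Antitone (fun n => u k lam (2 * n + 1) x) := fun x =>
    antitone_nat_of_succ_le fun n => u_odd hk hl n x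
  have te : ∀ x, ∃ l, Tendsto (fun n => u k lam (2 * n) x) atTop (𝓝 l) := fun x =>
    ⟨_, tendsto_atTop_ciSup (me x) ⟨1, by rintro _ ⟨n, rfl⟩; exact (u_mem hk hl _ x).2⟩⟩
  have tod : ∀ x, ∃ l, Tendsto (fun n => u k lam (2 * n + 1) x) atTop (𝓝 l) := fun x =>
    ⟨_, tendsto_atTop_ciInf (mo x) ⟨0, by rintro _ ⟨n, rfl⟩; exact (u_mem hk hl _ x).1⟩⟩
  choose f hf using te
  choose g hg using tod
  have bd : ∀ (w : ℝ → ℝ) (v : ℕ → ℕ), (∀ x, Tendsto (fun n => u k lam (v n) x) atTop (𝓝 (w x))) →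
      Adm lam w := by
    intro w v h
    have b : ∀ x, w x ∈ Icc (0 : ℝ) 1 := fun x =>
      isClosed_Icc.mem_of_tendsto (h x) (Eventually.of_forall fun n => u_mem hk hl _ x)
    have m : Measurable w :=
      measurable_of_tendsto_metrizable (fun n => (u_cont hk hl (v n)).measurable)
        (tendsto_pi_nhds.2 h)
    refine ⟨?_, fun x _ => b x⟩
    refine (intervalIntegrable_const (c := (1 : ℝ))).mono_fun m.aestronglyMeasurable ?_
    filter_upwards with x
    rw [Real.norm_of_nonneg (b x).1]
    simpa using (b x).2
  have Af := bd f _ hf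
  have Ag := bd g _ hg
  have hgf : g = S k lam f := by
    ext x
    refine tendsto_nhds_unique (hg x) ?_
    simp_rw [u_succ]
    exact S_tendsto hk hl (fun n => u_adm hk hl _) hf x
  have hfg : f = S k lam g := by
    ext x
    refine tendsto_nhds_unique ((hf x).comp (tendsto_add_atTop_nat 1)) ?_
    have : ((fun n => u k lam (2 * n) x) ∘ fun a => a + 1) =
        fun n => S k lam (u k lam (2 * n + 1)) x := by
      ext n
      rw [← u_succ]; rfl
    rw [this]
    exact S_tendsto hk hl (fun n => u_adm hk hl _) hg x
  have hle : ∀ x, f x ≤ g x := fun x =>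
    le_of_tendsto_of_tendsto' (hf x) (hg x) fun n => u_eo hk hl n x
  have E := two_cycle hk hl Af Ag hfg hgf hle
  have cf : Continuous f := hfg ▸ S_cont hk hl Ag
  refine ⟨f, ?_, ?_⟩
  · exact Monotone.tendstoUniformlyOn_of_forall_tendsto isCompact_Icc
      (fun n => (u_cont hk hl _).continuousOn) (fun x _ => me x) cf.continuousOn (fun x _ => hf x)
  · exact Antitone.tendstoUniformlyOn_of_forall_tendsto isCompact_Icc
      (fun n => (u_cont hk hl _).continuousOn) (fun x _ => mo x) cf.continuousOn
      (fun x hx => by rw [E x hx]; exact hg x)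

/-- The concrete kernel. -/
noncomputable def kk (d u : ℝ) : ℝ := d * (max u 0) ^ (d - 1)

lemma kk_ker {d : ℝ} (hd : 1 < d) : Ker (kk d) where
  cont := by
    unfold kk
    exact continuous_const.mul ((continuous_id.max continuous_const).rpow_const
      fun x => Or.inr (by linarith))
  mono := fun a b h => by
    unfold kk
    exact mul_le_mul_of_nonneg_left (Real.rpow_le_rpow (le_max_right _ _)
      (max_le_max_right _ h) (by linarith)) (by linarith)
  nonneg := fun a => mul_nonneg (by linarith) (Real.rpow_nonneg (le_max_right _ _) _)
  zero := fun a h => by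
    simp [kk, max_eq_right h, Real.zero_rpow (show d - 1 ≠ 0 by linarith)]
  pos := fun a h => by
    unfold kk
    rw [max_eq_left h.le]
    have := Real.rpow_pos_of_pos h (d - 1)
    positivity

lemma T_eq_S {d : ℝ} (hd : 1 < d) (hl : 0 < lam) {a b : ℝ → ℝ} (hb : Adm lam b)
    (hab : ∀ x ∈ Icc (-lam) lam, a x = b x) (x : ℝ) (hx : x ∈ Icc (-lam) lam) :
    T d lam a x = S (kk d) lam b x := by
  obtain ⟨hx1, hx2⟩ := hx
  have hk := kk_ker hd
  have hi := integ hk hb x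
  unfold T S L
  have hm : -x ∈ uIcc (-lam) lam := by
    rw [uIcc_of_le (by linarith)]; exact ⟨by linarith, by linarith⟩
  have i1 := hi.mono_set (uIcc_subset_uIcc left_mem_uIcc hm)
  have i2 := hi.mono_set (uIcc_subset_uIcc hm right_mem_uIcc)
  rw [← intervalIntegral.integral_add_adjacent_intervals i1 i2]
  have z : ∫ y in (-lam)..(-x), kk d (x + y) * b y = ∫ y in (-lam)..(-x), (0 : ℝ) := by
    apply intervalIntegral.integral_congr
    intro y hy
    rw [uIcc_of_le (by linarith)] at hy
    simp [hk.zero (x + y) (by linarith [hy.2])]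
  rw [z, ← intervalIntegral.integral_const_mul]
  simp only [intervalIntegral.integral_zero, zero_add]
  congr 2
  apply intervalIntegral.integral_congr
  intro y hy
  rw [uIcc_of_le (by linarith)] at hy
  have h1 := hy.1
  simp only [kk]
  rw [max_eq_left (by linarith), hab y ⟨by linarith, hy.2⟩]
  ring

lemma memF_adm (hl : 0 < lam) {f : ℝ → ℝ} (hf : memF lam f) : Adm lam f :=
  ⟨AntitoneOn.intervalIntegrable (by rw [uIcc_of_le (by linarith)]; exact hf.1), hf.2⟩

lemma T_iter {d : ℝ} (hd : 1 < d) (hl : 0 < lam) {f : ℝ → ℝ} (hf : Adm lam f) (n : ℕ) :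
    ∀ x ∈ Icc (-lam) lam, (T d lam)^[n] f x = (S (kk d) lam)^[n] f x := by
  induction n with
  | zero => intro x _; rfl
  | succ n ih =>
    intro x hx
    rw [Function.iterate_succ_apply', Function.iterate_succ_apply']
    exact T_eq_S hd hl (iter_adm (kk_ker hd) hl hf n) ih x hx

lemma S_fix {d : ℝ} (hd : 1 < d) (hl : 0 < lam) {f : ℝ → ℝ} (hf : Adm lam f)
    (hfix : ∀ x ∈ Icc (-lam) lam, T d lam f x = f x) (n : ℕ) :
    ∀ x ∈ Icc (-lam) lam, f x = (S (kk d) lam)^[n] f x := by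
  induction n with
  | zero => intro x _; rfl
  | succ n ih =>
    intro x hx
    rw [Function.iterate_succ_apply', ← hfix x hx]
    exact T_eq_S hd hl (iter_adm (kk_ker hd) hl hf n) ih x hx

end Cav

/-- the fixed point `f_λ` of `T` is globally attractive, uniformly in
both `x ∈ [-λ, λ]` and `f ∈ 𝔉`. -/
theorem truncated_cavity_fixedPoint_attractive (d lam : ℝ) (hd : 1 < d) (hlam : 0 < lam)
    (flam : ℝ → ℝ) (hflam : memF lam flam)
    (hfix : ∀ x ∈ Icc (-lam) lam, T d lam flam x = flam x) :
    ∀ ε > (0 : ℝ), ∃ N : ℕ, ∀ n ≥ N, ∀ f : ℝ → ℝ, memF lam f →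
      ∀ x ∈ Icc (-lam) lam, |(T d lam)^[n] f x - flam x| ≤ ε := by
  intro ε hε
  have hk := Cav.kk_ker hd
  obtain ⟨g, he, ho⟩ := Cav.limit hk hlam
  rw [Metric.tendstoUniformlyOn_iff] at he ho
  obtain ⟨N1, h1⟩ := eventually_atTop.1 (he (ε / 2) (by linarith))
  obtain ⟨N2, h2⟩ := eventually_atTop.1 (ho (ε / 2) (by linarith))
  refine ⟨2 * (N1 + N2), fun n hn f hf x hx => ?_⟩
  have Af := Cav.memF_adm hlam hf
  have Al := Cav.memF_adm hlam hflam
  rw [Cav.T_iter hd hlam Af n x hx, Cav.S_fix hd hlam Al hfix n x hx]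
  obtain ⟨m, hm⟩ := Nat.even_or_odd' n
  have a1 := h1 m (by omega) x hx
  have a2 := h2 m (by omega) x hx
  have a3 := h1 (m + 1) (by omega) x hx
  rw [show 2 * (m + 1) = 2 * m + 2 by ring] at a3
  rw [Real.dist_eq, abs_lt] at a1 a2 a3
  have s1 := Cav.sandwich hk hlam Af m
  have s2 := Cav.sandwich hk hlam Al m
  rw [abs_le]
  rcases hm with rfl | rfl
  · have b1 := s1.1 x hx
    have b2 := s2.1 x hx
    constructor <;> linarith
  · have b1 := s1.2 x hx
    have b2 := s2.2 x hx
    constructor <;> linarith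
end

section
/- For d > 1, 0 < λ < ∞, and any f ∈ 𝔉, the function Tf satisfies (Tf)(-λ) = 1 and the integral identity 1 - (Tf)(λ) = d(d-1) ∬_{[-λ,λ]²} (x+y)^{d-2} 1_{x+y ≥ 0} (Tf)(x) f(y) dx dy. -/
open MeasureTheory Set

/-- Extension of `f` to an antitone function on the line. -/
noncomputable def hExt (lam : ℝ) (f : ℝ → ℝ) : ℝ → ℝ :=
  fun y => if y < -lam then 1 else if y ≤ lam then f y else 0

lemma hExt_mem {lam : ℝ} {f : ℝ → ℝ} (hf : memF lam f) (y : ℝ) :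
    0 ≤ hExt lam f y ∧ hExt lam f y ≤ 1 := by
  unfold hExt
  split_ifs with h1 h2
  · norm_num
  · exact hf.2 y ⟨by linarith, h2⟩
  · norm_num

lemma hExt_anti {lam : ℝ} {f : ℝ → ℝ} (hf : memF lam f) : Antitone (hExt lam f) := by
  intro a b hab
  by_cases ha : a < -lam
  · have : hExt lam f a = 1 := by simp [hExt, ha]
    rw [this]; exact (hExt_mem hf b).2
  by_cases hb : lam < b
  · have : hExt lam f b = 0 := by
      unfold hExt
      split_ifs with h1 h2
      · exact absurd h1 (by linarith)
      · exact absurd h2 (by linarith)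
      · rfl
    rw [this]; exact (hExt_mem hf a).1
  push Not at ha hb
  have e1 : hExt lam f a = f a := by
    simp [hExt, not_lt.2 ha, hab.trans hb]
  have e2 : hExt lam f b = f b := by
    simp [hExt, not_lt.2 (ha.trans hab), hb]
  rw [e1, e2]
  exact hf.1 ⟨ha, hab.trans hb⟩ ⟨ha.trans hab, hb⟩ hab

lemma hExt_zero {lam : ℝ} (hlam : 0 < lam) (f : ℝ → ℝ) {y : ℝ} (hy : lam < y) :
    hExt lam f y = 0 := by
  simp [hExt, not_lt.2 (show -lam ≤ y by linarith), not_le.2 hy]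

lemma shift_integral {lam : ℝ} (hlam : 0 < lam) (f : ℝ → ℝ) (p x : ℝ)
    (hx : x ∈ Icc (-lam) lam) :
    ∫ u in (0:ℝ)..(2 * lam), u ^ p * hExt lam f (u - x)
      = ∫ y in Ioc (-x) lam, (x + y) ^ p * f y := by
  obtain ⟨hx1, hx2⟩ := hx
  have h1 := intervalIntegral.integral_comp_sub_right (a := 0) (b := 2 * lam)
    (fun y => (x + y) ^ p * hExt lam f y) x
  have h2 : ∀ u : ℝ, x + (u - x) = u := fun u => by ring
  simp only [h2] at h1
  rw [h1, intervalIntegral.integral_of_le (by linarith),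
    ← integral_indicator measurableSet_Ioc, ← integral_indicator measurableSet_Ioc]
  congr 1
  ext y
  by_cases hy : y ∈ Ioc (-x) lam
  · rw [indicator_of_mem hy, indicator_of_mem
      (show y ∈ Ioc (0 - x) (2 * lam - x) from ⟨by linarith [hy.1], by linarith [hy.2]⟩)]
    simp [hExt, not_lt.2 (show -lam ≤ y by linarith [hy.1]), hy.2]
  · rw [indicator_of_notMem hy]
    by_cases hy' : y ∈ Ioc (0 - x) (2 * lam - x)
    · rw [indicator_of_mem hy', hExt_zero hlam f, mul_zero]
      by_contra hc
      exact hy ⟨by linarith [hy'.1], by linarith⟩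
    · rw [indicator_of_notMem hy']

lemma inner_integral {lam : ℝ} (hlam : 0 < lam) (f : ℝ → ℝ) (p x c : ℝ)
    (hx : x ∈ Icc (-lam) lam) :
    ∫ y in Icc (-lam) lam, (if 0 ≤ x + y then (x + y) ^ p * (c * f y) else 0)
      = c * ∫ u in (0:ℝ)..(2 * lam), u ^ p * hExt lam f (u - x) := by
  rw [shift_integral hlam f p x hx, ← integral_const_mul,
    ← integral_indicator measurableSet_Icc, ← integral_indicator measurableSet_Ioc]
  apply integral_congr_ae
  have : ∀ᵐ y : ℝ, y ≠ -x := by simp [ae_iff]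
  filter_upwards [this] with y hy
  by_cases h : y ∈ Ioc (-x) lam
  · rw [indicator_of_mem h, indicator_of_mem
      (show y ∈ Icc (-lam) lam from ⟨by linarith [h.1, hx.2], h.2⟩),
      if_pos (by linarith [h.1])]
    ring
  · rw [indicator_of_notMem h]
    by_cases h' : y ∈ Icc (-lam) lam
    · rw [indicator_of_mem h', if_neg]
      intro hc
      exact h ⟨lt_of_le_of_ne (by linarith) (Ne.symm hy), h'.2⟩
    · rw [indicator_of_notMem h']

/-- The function `G`. -/
noncomputable def GG (d lam : ℝ) (f : ℝ → ℝ) : ℝ → ℝ :=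
  fun x => ∫ u in (0:ℝ)..(2 * lam), u ^ (d - 2) * hExt lam f (u - x)

lemma GG_cont (d lam : ℝ) (hd : 1 < d) (hlam : 0 < lam)
    (f : ℝ → ℝ) (hf : memF lam f) : Continuous (GG d lam f) := by
  unfold GG
  have hm : Measurable (hExt lam f) := (hExt_anti hf).measurable
  refine continuous_iff_continuousAt.2 fun x₀ => ?_
  apply intervalIntegral.continuousAt_of_dominated_interval (bound := fun u => u ^ (d - 2))
  · refine Filter.Eventually.of_forall fun x => ?_
    apply Measurable.aestronglyMeasurable
    fun_prop
  · refine Filter.Eventually.of_forall fun x => ?_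
    refine Filter.Eventually.of_forall fun u hu => ?_
    rw [uIoc_of_le (by linarith)] at hu
    have h0 : 0 ≤ u ^ (d - 2) := Real.rpow_nonneg hu.1.le _
    have := hExt_mem hf (u - x)
    rw [Real.norm_of_nonneg (mul_nonneg h0 this.1)]
    exact mul_le_of_le_one_right h0 this.2
  · exact intervalIntegral.intervalIntegrable_rpow' (by linarith)
  · have hcount : {u : ℝ | ¬ ContinuousAt (hExt lam f) (u - x₀)}.Countable :=
      (hExt_anti hf).countable_not_continuousAt.preimage (sub_left_injective (b := x₀))
    filter_upwards [hcount.ae_notMem volume] with u hu _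
    have hc : ContinuousAt (hExt lam f) (u - x₀) := by simpa using hu
    refine continuousAt_const.mul ?_
    exact ContinuousAt.comp (f := fun x => u - x) (x := x₀) hc (by fun_prop)

lemma F_eq (d lam : ℝ) (hd : 1 < d) (hlam : 0 < lam)
    (f : ℝ → ℝ) (hf : memF lam f) (x : ℝ) (hx : x ∈ Icc (-lam) lam) :
    ∫ y in (-x)..lam, (x + y) ^ (d - 1) * f y = (d - 1) * ∫ t in (-lam)..x, GG d lam f t := by
  have hm : Measurable (hExt lam f) := (hExt_anti hf).measurable
  have hII : ∀ a b, IntervalIntegrable (hExt lam f) volume a b :=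
    fun a b => (hExt_anti hf).intervalIntegrable
  rw [intervalIntegral.integral_of_le (by linarith [hx.1]), ← shift_integral hlam f _ x hx]
  -- swap
  have hswap : ∫ t in (-lam)..x, GG d lam f t =
      ∫ u in (0:ℝ)..(2 * lam), u ^ (d - 2) * ∫ y in (u - x)..lam, hExt lam f y := by
    unfold GG
    rw [intervalIntegral_intervalIntegral_swap]
    · apply intervalIntegral.integral_congr
      intro u hu
      rw [uIcc_of_le (by linarith)] at hu
      simp only
      rw [intervalIntegral.integral_const_mul]
      congr 1
      rw [intervalIntegral.integral_comp_sub_left (fun y => hExt lam f y) u,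
        ← intervalIntegral.integral_add_adjacent_intervals (hII (u - x) lam) (hII lam _)]
      have : ∫ y in lam..(u - -lam), hExt lam f y = 0 := by
        rw [intervalIntegral.integral_of_le (by linarith [hu.1])]
        exact setIntegral_eq_zero_of_forall_eq_zero fun y hy => hExt_zero hlam f hy.1
      rw [this, add_zero]
    · have hb : Integrable (fun z : ℝ × ℝ => (1 : ℝ) * z.2 ^ (d - 2))
          ((volume.restrict (uIoc (-lam) x)).prod (volume.restrict (uIoc 0 (2 * lam)))) := by
        apply Integrable.mul_prod (f := fun _ : ℝ => (1 : ℝ)) (g := fun u : ℝ => u ^ (d - 2))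
        · exact intervalIntegrable_iff.1 intervalIntegrable_const
        · exact intervalIntegrable_iff.1
            (intervalIntegral.intervalIntegrable_rpow' (by linarith))
      have hb' : Integrable (fun z : ℝ × ℝ => z.2 ^ (d - 2) * hExt lam f (z.2 - z.1))
          ((volume.restrict (uIoc (-lam) x)).prod (volume.restrict (uIoc 0 (2 * lam)))) := by
        refine hb.mono ?_ (Filter.Eventually.of_forall fun z => ?_)
        · apply Measurable.aestronglyMeasurable
          fun_prop
        · have := hExt_mem hf (z.2 - z.1)
          rw [norm_mul, one_mul, Real.norm_of_nonneg this.1]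
          exact mul_le_of_le_one_right (norm_nonneg _) this.2
      rw [Measure.prod_restrict] at hb'
      exact hb'
  rw [hswap]
  set H : ℝ → ℝ := fun u => ∫ y in (u - x)..lam, hExt lam f y with hH
  have hHc : Continuous H := by
    have h1 : Continuous fun b => ∫ y in lam..b, hExt lam f y :=
      intervalIntegral.continuous_primitive hII lam
    have h2 : H = fun u => - ∫ y in lam..(u - x), hExt lam f y := by
      ext u
      exact intervalIntegral.integral_symm _ _
    rw [h2]
    exact (h1.comp (continuous_id.sub continuous_const)).neg
  have hcount : {u : ℝ | ¬ ContinuousAt (hExt lam f) (u - x)}.Countable := by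
    have := (hExt_anti hf).countable_not_continuousAt
    exact this.preimage (sub_left_injective (b := x))
  have hi1 : IntervalIntegrable (fun u : ℝ => u ^ (d - 2) * H u) volume 0 (2 * lam) :=
    (intervalIntegral.intervalIntegrable_rpow' (by linarith)).mul_continuousOn hHc.continuousOn
  have hi2 : IntervalIntegrable (fun u : ℝ => u ^ (d - 1) * hExt lam f (u - x)) volume
      0 (2 * lam) := by
    apply IntervalIntegrable.continuousOn_mul
    · exact ((hExt_anti hf).comp_monotone
        (show Monotone (fun u : ℝ => u - x) from fun a b h => by simpa using h)).intervalIntegrable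
    · exact (Real.continuous_rpow_const (by linarith)).continuousOn
  have key := MeasureTheory.integral_eq_of_hasDerivAt_off_countable
    (fun u : ℝ => u ^ (d - 1) * H u)
    (fun u => (d - 1) * (u ^ (d - 2) * H u) - u ^ (d - 1) * hExt lam f (u - x))
    (a := 0) (b := 2 * lam) hcount
    (((Real.continuous_rpow_const (by linarith)).mul hHc).continuousOn)
    ?_ ((hi1.const_mul _).sub hi2)
  · rw [intervalIntegral.integral_sub (hi1.const_mul _) hi2,
      intervalIntegral.integral_const_mul] at key
    have e1 : H (2 * lam) = 0 := by
      rw [hH]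
      simp only
      rw [intervalIntegral.integral_symm, intervalIntegral.integral_of_le (by linarith [hx.2]),
        setIntegral_eq_zero_of_forall_eq_zero fun y hy => hExt_zero hlam f hy.1, neg_zero]
    rw [e1, Real.zero_rpow (by linarith)] at key
    linarith
  · rintro u ⟨hu, hc⟩
    rw [min_eq_left (by linarith), max_eq_right (by linarith)] at hu
    have hc' : ContinuousAt (hExt lam f) (u - x) := by simpa using hc
    have d1 := Real.hasDerivAt_rpow_const (x := u) (p := d - 1) (Or.inl hu.1.ne')
    have d2 : HasDerivAt H (-hExt lam f (u - x)) u := by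
      have := intervalIntegral.integral_hasDerivAt_left (hII (u - x) lam)
        (hm.stronglyMeasurable.stronglyMeasurableAtFilter) hc'
      have h2 := HasDerivAt.comp u this ((hasDerivAt_id u).sub_const x)
      rw [mul_one] at h2
      exact h2
    refine (d1.mul d2).congr_deriv ?_
    rw [show d - 1 - 1 = d - 2 by ring]
    ring

/-- `(Tf)(-λ) = 1` and the double-integral identity for `1 - (Tf)(λ)`. -/
theorem truncated_cavity_integral_identity (d lam : ℝ) (hd : 1 < d) (hlam : 0 < lam)
    (f : ℝ → ℝ) (hf : memF lam f) :
    T d lam f (-lam) = 1 ∧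
    1 - T d lam f lam =
      d * (d - 1) *
        ∫ x in Icc (-lam) lam, ∫ y in Icc (-lam) lam,
          (if 0 ≤ x + y then (x + y) ^ (d - 2) * (T d lam f x * f y) else 0) := by
  have hT : ∀ x ∈ Icc (-lam) lam,
      T d lam f x = Real.exp (-(d * ((d - 1) * ∫ t in (-lam)..x, GG d lam f t))) := by
    intro x hx
    unfold T
    rw [F_eq d lam hd hlam f hf x hx]
  have hG := GG_cont d lam hd hlam f hf
  have hl : -lam ≤ lam := by linarith
  have h1 : T d lam f (-lam) = 1 := by
    rw [hT _ ⟨le_rfl, hl⟩]; simp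
  refine ⟨h1, ?_⟩
  have hcong : ∫ x in Icc (-lam) lam, ∫ y in Icc (-lam) lam,
          (if 0 ≤ x + y then (x + y) ^ (d - 2) * (T d lam f x * f y) else 0) =
      ∫ x in Icc (-lam) lam,
        Real.exp (-(d * ((d - 1) * ∫ t in (-lam)..x, GG d lam f t))) * GG d lam f x := by
    apply setIntegral_congr_fun measurableSet_Icc
    intro x hx
    simp only
    rw [inner_integral hlam f _ x _ hx, hT x hx]
    rfl
  rw [hcong, integral_Icc_eq_integral_Ioc, ← intervalIntegral.integral_of_le hl]
  have hder : ∀ x, HasDerivAt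
      (fun x => Real.exp (-(d * ((d - 1) * ∫ t in (-lam)..x, GG d lam f t))))
      (-(d * (d - 1)) *
        (Real.exp (-(d * ((d - 1) * ∫ t in (-lam)..x, GG d lam f t))) * GG d lam f x)) x := by
    intro x
    have := (((hG.integral_hasStrictDerivAt (-lam) x).hasDerivAt.const_mul (d - 1)).const_mul
      d).neg.exp
    refine HasDerivAt.congr_deriv this ?_
    simp only [Pi.neg_apply]
    ring
  have hcont : Continuous
      (fun x => Real.exp (-(d * ((d - 1) * ∫ t in (-lam)..x, GG d lam f t)))) :=
    continuous_iff_continuousAt.2 fun x => (hder x).continuousAt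
  have key := intervalIntegral.integral_eq_sub_of_hasDerivAt (a := -lam) (b := lam)
    (fun x _ => hder x) ((continuous_const.mul (hcont.mul hG)).intervalIntegrable _ _)
  rw [intervalIntegral.integral_const_mul, ← hT _ ⟨le_rfl, hl⟩, ← hT _ ⟨hl, le_rfl⟩, h1] at key
  linarith
end

section
/- Fix d > 1. There exists exactly one measurable non-increasing function f : ℝ → [0,1] solving the un-truncated Mézard–Parisi cavity equation f(x) = exp(-d ∫_{-x}^{∞} (x+y)^{d-1} f(y) dy) for all x ∈ ℝ; moreover, the extended fixed points f_λ of the truncated operators converge to f pointwise on ℝ as λ → +∞, and ∫_{-λ}^{λ} f_λ(x) ln f_λ(x) dx converges to ∫_ℝ f(x) ln f(x) dx as λ → +∞. -/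
open MeasureTheory Set Filter

/-- `f` is the fixed point of the truncated cavity operator on `[-λ, λ]`
(non-increasing and `[0,1]`-valued there), extended to `ℝ` by `1` on `(-∞, -λ]`
and `0` on `(λ, ∞)`. -/
def ExtFixedPoint (d lam : ℝ) (f : ℝ → ℝ) : Prop :=
  AntitoneOn f (Icc (-lam) lam) ∧
  (∀ x ∈ Icc (-lam) lam, f x ∈ Icc (0 : ℝ) 1) ∧
  (∀ x ≤ -lam, f x = 1) ∧ (∀ x > lam, f x = 0) ∧
  (∀ x ∈ Icc (-lam) lam, T d lam f x = f x)

/-- `f : ℝ → [0,1]` is a measurable solution of the un-truncated Mézard–Parisi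
cavity equation `f(x) = exp(-d ∫_{-x}^∞ (x+y)^{d-1} f(y) dy)`, the integrals
being (finite and) well-defined. -/
def SolvesCavity (d : ℝ) (f : ℝ → ℝ) : Prop :=
  Measurable f ∧ (∀ x : ℝ, f x ∈ Icc (0 : ℝ) 1) ∧
  (∀ x : ℝ, IntegrableOn (fun y => (x + y) ^ (d - 1) * f y) (Ioi (-x))) ∧
  (∀ x : ℝ, f x = Real.exp (-(d * ∫ y in Ioi (-x), (x + y) ^ (d - 1) * f y)))


namespace MP

/-- the kernel -/
noncomputable def kk (d s : ℝ) : ℝ := d * (max s 0) ^ (d - 1)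

/-- the linear operator -/
noncomputable def AA (d : ℝ) (h : ℝ → ℝ) (x : ℝ) : ℝ := ∫ y, kk d (x + y) * h y

/-- the dominating function -/
noncomputable def GG (d y : ℝ) : ℝ := Real.exp (-(Real.exp (-1) * (max y 0) ^ d))

lemma kk_nonneg {d : ℝ} (hd : 1 < d) (s : ℝ) : 0 ≤ kk d s := by
  unfold kk
  have : (0:ℝ) ≤ max s 0 := le_max_right _ _
  positivity

lemma kk_of_nonpos {d : ℝ} (hd : 1 < d) {s : ℝ} (hs : s ≤ 0) : kk d s = 0 := by
  unfold kk
  rw [max_eq_right hs, Real.zero_rpow (by linarith), mul_zero]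

lemma kk_of_nonneg {d : ℝ} {s : ℝ} (hs : 0 ≤ s) : kk d s = d * s ^ (d - 1) := by
  unfold kk
  rw [max_eq_left hs]

lemma kk_pos {d : ℝ} (hd : 1 < d) {s : ℝ} (hs : 0 < s) : 0 < kk d s := by
  rw [kk_of_nonneg hs.le]
  positivity

lemma kk_mono {d : ℝ} (hd : 1 < d) : Monotone (kk d) := by
  intro s t hst
  unfold kk
  have : (0:ℝ) ≤ max s 0 := le_max_right _ _
  apply mul_le_mul_of_nonneg_left _ (by linarith)
  apply Real.rpow_le_rpow this (max_le_max_right _ hst) (by linarith)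

lemma kk_cont {d : ℝ} (hd : 1 < d) : Continuous (kk d) := by
  unfold kk
  apply Continuous.mul continuous_const
  apply Continuous.rpow_const (by fun_prop)
  intro x; right; linarith

lemma kk_add_le {d : ℝ} (hd : 1 < d) (x y : ℝ) :
    kk d (x + y) ≤ 2 ^ (d - 1) * (kk d x + kk d y) := by
  have key : ∀ x y : ℝ, x ≤ y → kk d (x + y) ≤ 2 ^ (d - 1) * kk d y := by
    intro x y hxy
    rcases le_total y 0 with hy | hy
    · rw [kk_of_nonpos hd (by linarith)]
      have := kk_nonneg hd y
      positivity
    · calc kk d (x + y) ≤ kk d (2 * y) := kk_mono hd (by linarith)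
        _ = _ := by
          rw [kk_of_nonneg (by linarith), kk_of_nonneg hy, Real.mul_rpow (by norm_num) hy]
          ring
  have h2 : (0:ℝ) < 2 ^ (d - 1) := by positivity
  have h3 := kk_nonneg hd x
  have h4 := kk_nonneg hd y
  rcases le_total x y with h | h
  · have := key x y h
    nlinarith
  · have := key y x h
    rw [add_comm y x] at this
    nlinarith

lemma kk_add_integrableOn {d : ℝ} (hd : 1 < d) (x : ℝ) :
    IntegrableOn (fun y => kk d (x + y)) (Iic 0) := by
  have h1 : IntegrableOn (fun y => kk d (x + y)) (Icc (-|x|) 0) :=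
    ((kk_cont hd).comp (by fun_prop)).continuousOn.integrableOn_Icc
  apply h1.of_forall_sdiff_eq_zero measurableSet_Iic
  intro y hy
  apply kk_of_nonpos hd
  simp only [Set.mem_sdiff, mem_Iic, mem_Icc, not_and'] at hy
  have := hy.2 hy.1
  have := neg_abs_le x
  have := le_abs_self x
  linarith

lemma kk_integral_Iic {d : ℝ} (hd : 1 < d) {x : ℝ} (hx : 0 ≤ x) :
    ∫ y in Iic 0, kk d (x + y) = x ^ d := by
  have h1 : ∫ y in Iic 0, kk d (x + y) = ∫ y in Ioc (-x) 0, kk d (x + y) := by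
    apply setIntegral_eq_of_subset_of_forall_sdiff_eq_zero measurableSet_Iic
    · exact fun y hy => hy.2
    · intro y hy
      apply kk_of_nonpos hd
      simp only [Set.mem_sdiff, mem_Iic, mem_Ioc, not_and'] at hy
      have := hy.2 hy.1
      linarith
  rw [h1, ← intervalIntegral.integral_of_le (by linarith),
    intervalIntegral.integral_comp_add_left (fun s => kk d s) x]
  simp only [add_neg_cancel, add_zero]
  have h2 : ∫ s in (0:ℝ)..x, kk d s = ∫ s in (0:ℝ)..x, d * s ^ (d - 1) := by
    apply intervalIntegral.integral_congr
    intro s hs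
    rw [uIcc_of_le hx] at hs
    exact kk_of_nonneg hs.1
  rw [h2, intervalIntegral.integral_const_mul, integral_rpow (by left; linarith)]
  rw [sub_add_cancel, Real.zero_rpow (by linarith)]
  field_simp
  simp

lemma exp_deriv {d : ℝ} (hd : 1 < d) (p : ℝ) (x : ℝ) (hx : 0 ≤ x) :
    HasDerivAt (fun y : ℝ => -Real.exp (-(p * y ^ d)))
      (kk d x * (p * Real.exp (-(p * x ^ d)))) x := by
  have h1 : HasDerivAt (fun y : ℝ => y ^ d) (d * x ^ (d - 1)) x :=
    Real.hasDerivAt_rpow_const (Or.inr hd.le)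
  have h2 : HasDerivAt (fun y : ℝ => -Real.exp (-(p * y ^ d)))
      (-(Real.exp (-(p * x ^ d)) * -(p * (d * x ^ (d - 1))))) x := ((h1.const_mul p).neg.exp).neg
  refine h2.congr_deriv ?_
  rw [kk_of_nonneg hx]
  ring

lemma exp_tendsto {d : ℝ} (hd : 1 < d) {p : ℝ} (hp : 0 < p) :
    Tendsto (fun y : ℝ => -Real.exp (-(p * y ^ d))) atTop (nhds 0) := by
  have h1 : Tendsto (fun y : ℝ => p * y ^ d) atTop atTop :=
    (tendsto_rpow_atTop (by linarith)).const_mul_atTop hp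
  have h2 := (Real.tendsto_exp_neg_atTop_nhds_zero.comp h1).neg
  simpa using h2

lemma kexp_integrableOn {d : ℝ} (hd : 1 < d) {p : ℝ} (hp : 0 < p) {s : ℝ} (hs : 0 ≤ s) :
    IntegrableOn (fun x => kk d x * (p * Real.exp (-(p * x ^ d)))) (Ioi s) := by
  apply integrableOn_Ioi_deriv_of_nonneg' (fun x hx => exp_deriv hd p x (hs.trans hx)) _
    (exp_tendsto hd hp)
  intro x _
  have := kk_nonneg hd x
  positivity

lemma kexp_integral {d : ℝ} (hd : 1 < d) {p : ℝ} (hp : 0 < p) {s : ℝ} (hs : 0 ≤ s) :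
    ∫ x in Ioi s, kk d x * (p * Real.exp (-(p * x ^ d))) = Real.exp (-(p * s ^ d)) := by
  rw [integral_Ioi_of_hasDerivAt_of_nonneg' (fun x hx => exp_deriv hd p x (hs.trans hx)) _
    (exp_tendsto hd hp)]
  · simp
  intro x _
  have := kk_nonneg hd x
  positivity

lemma exp_integrableOn {d : ℝ} (hd : 1 < d) {p : ℝ} (hp : 0 < p) :
    IntegrableOn (fun x : ℝ => Real.exp (-(p * x ^ d))) (Ioi 0) := by
  have := integrableOn_rpow_mul_exp_neg_mul_rpow (p := d) (s := 0) (b := p) (by norm_num)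
    (by linarith) hp
  simpa using this

lemma GG_of_nonneg {d y : ℝ} (hy : 0 ≤ y) : GG d y = Real.exp (-(Real.exp (-1) * y ^ d)) := by
  unfold GG; rw [max_eq_left hy]

lemma GG_of_nonpos {d y : ℝ} (hd : 1 < d) (hy : y ≤ 0) : GG d y = 1 := by
  unfold GG; rw [max_eq_right hy, Real.zero_rpow (by linarith)]; simp

lemma GG_le_one {d y : ℝ} : GG d y ≤ 1 := by
  unfold GG
  rw [Real.exp_le_one_iff]
  have : (0:ℝ) ≤ max y 0 := le_max_right _ _
  have : 0 ≤ Real.exp (-1) * (max y 0) ^ d := by positivity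
  linarith

lemma GG_pos {d y : ℝ} : 0 < GG d y := Real.exp_pos _

lemma GG_cont {d : ℝ} (hd : 1 < d) : Continuous (GG d) := by
  unfold GG
  apply Real.continuous_exp.comp
  apply Continuous.neg
  apply Continuous.mul continuous_const
  apply Continuous.rpow_const (by fun_prop)
  intro x; right; linarith

lemma GG_integrableOn {d : ℝ} (hd : 1 < d) : IntegrableOn (GG d) (Ioi 0) := by
  apply (exp_integrableOn hd (Real.exp_pos (-1))).congr_fun _ measurableSet_Ioi
  intro y hy
  exact (GG_of_nonneg (le_of_lt hy)).symm

lemma kG_integrableOn {d : ℝ} (hd : 1 < d) : IntegrableOn (fun y => kk d y * GG d y) (Ioi 0) := by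
  have := (kexp_integrableOn hd (Real.exp_pos (-1)) le_rfl).const_mul (Real.exp 1)
  apply IntegrableOn.congr_fun this _ measurableSet_Ioi
  intro y hy
  simp only
  rw [GG_of_nonneg (le_of_lt hy)]
  have : Real.exp 1 * Real.exp (-1) = 1 := by rw [← Real.exp_add]; simp
  linear_combination (kk d y * Real.exp (-(Real.exp (-1) * y ^ d))) * this

lemma kkG_integrable {d : ℝ} (hd : 1 < d) (x : ℝ) :
    Integrable (fun y => kk d (x + y) * GG d y) := by
  have hc : Continuous (fun y => kk d (x + y) * GG d y) :=
    ((kk_cont hd).comp (by fun_prop)).mul (GG_cont hd)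
  rw [← integrableOn_univ, ← Iic_union_Ioi (a := (0:ℝ)), integrableOn_union]
  constructor
  · apply Integrable.mono' (kk_add_integrableOn hd x) hc.aestronglyMeasurable
    refine Eventually.of_forall fun y => ?_
    have h1 := kk_nonneg hd (x + y)
    have h2 := @GG_pos d y
    have h3 := @GG_le_one d y
    rw [Real.norm_of_nonneg (by positivity)]
    nlinarith
  · have h0 : IntegrableOn (fun y => 2 ^ (d - 1) * (kk d x * GG d y + kk d y * GG d y)) (Ioi 0) :=
      (((GG_integrableOn hd).const_mul (kk d x)).add (kG_integrableOn hd)).const_mul _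
    apply Integrable.mono' h0 hc.aestronglyMeasurable
    refine Eventually.of_forall fun y => ?_
    have h1 := kk_nonneg hd (x + y)
    have h2 := @GG_pos d y
    have h3 := kk_add_le hd x y
    rw [Real.norm_of_nonneg (by positivity)]
    nlinarith

/-- admissible functions -/
structure Good (d : ℝ) (h : ℝ → ℝ) : Prop where
  anti : Antitone h
  nonneg : ∀ y, 0 ≤ h y
  decay : ∀ y, h y ≤ GG d y

lemma Good.le_one {d : ℝ} {h : ℝ → ℝ} (hh : Good d h) (y : ℝ) : h y ≤ 1 :=
  (hh.decay y).trans GG_le_one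

lemma Good.bound {d : ℝ} (hd : 1 < d) {h : ℝ → ℝ} (hh : Good d h) (x y : ℝ) :
    ‖kk d (x + y) * h y‖ ≤ kk d (x + y) * GG d y := by
  have h1 := kk_nonneg hd (x + y)
  have h2 := hh.nonneg y
  rw [Real.norm_of_nonneg (by positivity)]
  exact mul_le_mul_of_nonneg_left (hh.decay y) h1

lemma Good.meas {d : ℝ} (hd : 1 < d) {h : ℝ → ℝ} (hh : Good d h) (x : ℝ) :
    AEStronglyMeasurable (fun y => kk d (x + y) * h y) := by
  apply Measurable.aestronglyMeasurable
  apply Measurable.mul _ hh.anti.measurable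
  exact ((kk_cont hd).comp (by fun_prop : Continuous fun y => x + y)).measurable

lemma Good.integrable {d : ℝ} (hd : 1 < d) {h : ℝ → ℝ} (hh : Good d h) (x : ℝ) :
    Integrable (fun y => kk d (x + y) * h y) := by
  apply Integrable.mono' (kkG_integrable hd x) (hh.meas hd x)
  exact Eventually.of_forall fun y => hh.bound hd x y

lemma Good.cont {d : ℝ} (hd : 1 < d) {h : ℝ → ℝ} (hh : Good d h) : Continuous (AA d h) := by
  rw [continuous_iff_continuousAt]
  intro x
  unfold AA
  apply continuousAt_of_dominated (bound := fun y => kk d (x + 1 + y) * GG d y)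
  · exact Eventually.of_forall fun x => hh.meas hd x
  · filter_upwards [Iio_mem_nhds (show x < x + 1 by linarith)] with z hz
    refine Eventually.of_forall fun y => (hh.bound hd z y).trans ?_
    apply mul_le_mul_of_nonneg_right _ GG_pos.le
    apply kk_mono hd
    have := mem_Iio.1 hz
    linarith
  · exact kkG_integrable hd _
  · refine Eventually.of_forall fun y => Continuous.continuousAt ?_
    exact ((kk_cont hd).comp (by fun_prop)).mul continuous_const

/-- decay lemma -/
lemma decay {d : ℝ} (hd : 1 < d) {h : ℝ → ℝ} (anti : Antitone h) (h0 : ∀ y, 0 ≤ h y)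
    (h1 : ∀ y, h y ≤ 1) (hint : ∀ x, Integrable (fun y => kk d (x + y) * h y))
    (he : h 0 = Real.exp (-AA d h 0)) (hle : ∀ y, 0 ≤ y → h y ≤ Real.exp (-AA d h y)) :
    Good d h := by
  refine ⟨anti, h0, ?_⟩
  have hp : 0 < h 0 := by rw [he]; exact Real.exp_pos _
  have k1 : ∀ y, 0 ≤ y → AA d h 0 + h 0 * y ^ d ≤ AA d h y := by
    intro y hy
    have e1 : ∫ z, (Iic (0:ℝ)).indicator (fun z => h 0 * kk d (y + z)) z = h 0 * y ^ d := by
      rw [integral_indicator measurableSet_Iic, integral_const_mul, kk_integral_Iic hd hy]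
    have i1 : Integrable ((Iic (0:ℝ)).indicator (fun z => h 0 * kk d (y + z))) := by
      rw [integrable_indicator_iff measurableSet_Iic]
      exact (kk_add_integrableOn hd y).const_mul _
    rw [← e1]
    unfold AA
    rw [← integral_add (hint 0) i1]
    apply integral_mono ((hint 0).add i1) (hint y)
    intro z
    simp only [Pi.add_apply]
    by_cases hz : z ≤ 0
    · rw [indicator_of_mem (show z ∈ Iic 0 from hz), kk_of_nonpos hd (by linarith : 0 + z ≤ 0)]
      have := kk_nonneg hd (y + z)
      have := anti hz
      nlinarith
    · rw [indicator_of_notMem (show z ∉ Iic 0 from hz), add_zero]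
      exact mul_le_mul_of_nonneg_right (kk_mono hd (by linarith)) (h0 z)
  have k2 : ∀ y, 0 ≤ y → h y ≤ h 0 * Real.exp (-(h 0 * y ^ d)) := by
    intro y hy
    apply (hle y hy).trans
    conv_rhs => rw [he, ← Real.exp_add, ← he]
    rw [Real.exp_le_exp]
    linarith [k1 y hy]
  have k3 : AA d h 0 ≤ 1 := by
    have e1 : AA d h 0 = ∫ z in Ioi 0, kk d z * h z := by
      unfold AA
      rw [setIntegral_eq_integral_of_forall_compl_eq_zero]
      · simp
      · intro z hz
        rw [kk_of_nonpos hd (by simpa using hz), zero_mul]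
    rw [e1]
    have e2 := kexp_integral hd hp le_rfl
    rw [Real.zero_rpow (by linarith), mul_zero, neg_zero, Real.exp_zero] at e2
    rw [← e2]
    apply setIntegral_mono_on _ (kexp_integrableOn hd hp le_rfl) measurableSet_Ioi
    · intro z hz
      exact mul_le_mul_of_nonneg_left (k2 z (le_of_lt hz)) (kk_nonneg hd z)
    · have := (hint 0).integrableOn (s := Ioi 0)
      simpa using this
  have k4 : Real.exp (-1) ≤ h 0 := by
    rw [he, Real.exp_le_exp]; linarith
  intro y
  rcases le_total y 0 with hy | hy
  · rw [GG_of_nonpos hd hy]; exact h1 y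
  · rw [GG_of_nonneg hy]
    apply (k2 y hy).trans
    have : Real.exp (-(h 0 * y ^ d)) ≤ Real.exp (-(Real.exp (-1) * y ^ d)) := by
      rw [Real.exp_le_exp]
      have : 0 ≤ y ^ d := by positivity
      nlinarith
    have := h1 0
    have := Real.exp_pos (-(h 0 * y ^ d))
    nlinarith

lemma AA_nonneg {d : ℝ} (hd : 1 < d) {h : ℝ → ℝ} (h0 : ∀ y, 0 ≤ h y) (x : ℝ) : 0 ≤ AA d h x :=
  integral_nonneg fun y => mul_nonneg (kk_nonneg hd _) (h0 y)

/-- bound of `A` on the negative axis -/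
lemma Good.AA_neg {d : ℝ} (hd : 1 < d) {h : ℝ → ℝ} (hh : Good d h) {s : ℝ} (hs : 0 ≤ s) :
    AA d h (-s) ≤ Real.exp 1 * GG d s := by
  have e1 : AA d h (-s) = ∫ z in Ioi s, kk d (-s + z) * h z := by
    unfold AA
    rw [setIntegral_eq_integral_of_forall_compl_eq_zero]
    intro z hz
    rw [kk_of_nonpos hd (by simpa using hz), zero_mul]
  rw [e1, GG_of_nonneg hs, ← kexp_integral hd (Real.exp_pos (-1)) hs, ← integral_const_mul]
  apply setIntegral_mono_on (hh.integrable hd _).integrableOn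
    ((kexp_integrableOn hd (Real.exp_pos (-1)) hs).const_mul _) measurableSet_Ioi
  intro z hz
  have hz' : s < z := hz
  have a1 := hh.decay z
  rw [GG_of_nonneg (by linarith)] at a1
  have a2 : kk d (-s + z) ≤ kk d z := kk_mono hd (by linarith)
  have a3 := hh.nonneg z
  have a4 := kk_nonneg hd z
  have : Real.exp 1 * Real.exp (-1) = 1 := by rw [← Real.exp_add]; simp
  calc kk d (-s + z) * h z ≤ kk d z * Real.exp (-(Real.exp (-1) * z ^ d)) := by gcongr
    _ = _ := by
      linear_combination (-(kk d z * Real.exp (-(Real.exp (-1) * z ^ d)))) * this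

end MP

namespace MP

/-- good solutions -/
structure Sol (d : ℝ) (f : ℝ → ℝ) : Prop where
  good : Good d f
  eq : ∀ x, f x = Real.exp (-AA d f x)

lemma Sol.pos {d : ℝ} {f : ℝ → ℝ} (hf : Sol d f) (x : ℝ) : 0 < f x := by
  rw [hf.eq]; exact Real.exp_pos _

lemma Sol.cont {d : ℝ} (hd : 1 < d) {f : ℝ → ℝ} (hf : Sol d f) : Continuous f := by
  have : f = fun x => Real.exp (-AA d f x) := funext hf.eq
  rw [this]
  exact Real.continuous_exp.comp (hf.good.cont hd).neg

lemma Sol.le_iff {d : ℝ} {f g : ℝ → ℝ} (hf : Sol d f) (hg : Sol d g) {x z : ℝ} :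
    f x ≤ g z ↔ AA d g z ≤ AA d f x := by
  rw [hf.eq, hg.eq, Real.exp_le_exp, neg_le_neg_iff]

lemma Sol.lt_iff {d : ℝ} {f g : ℝ → ℝ} (hf : Sol d f) (hg : Sol d g) {x z : ℝ} :
    f x < g z ↔ AA d g z < AA d f x := by
  rw [hf.eq, hg.eq, Real.exp_lt_exp, neg_lt_neg_iff]

lemma AA_shift {d : ℝ} (g : ℝ → ℝ) (x a : ℝ) :
    AA d g (x + a) = ∫ y, kk d (x + y) * g (y - a) := by
  unfold AA
  rw [← integral_add_right_eq_self (fun y => kk d (x + a + y) * g y) (-a)]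
  congr 1
  ext y
  congr 2
  ring

lemma AA_shift' {d : ℝ} (g : ℝ → ℝ) (x a : ℝ) :
    AA d g (x - a) = ∫ y, kk d (x + y) * g (y + a) := by
  have := @AA_shift d g x (-a)
  simpa [sub_eq_add_neg] using this

lemma Good.shift_int {d : ℝ} (hd : 1 < d) {g : ℝ → ℝ} (hg : Good d g) (x a : ℝ) :
    Integrable (fun y => kk d (x + y) * g (y - a)) := by
  have := (hg.integrable hd (x + a)).comp_add_right (-a)
  refine this.congr (Eventually.of_forall fun y => ?_)
  simp only
  congr 2
  ring

lemma Good.shift_int' {d : ℝ} (hd : 1 < d) {g : ℝ → ℝ} (hg : Good d g) (x a : ℝ) :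
    Integrable (fun y => kk d (x + y) * g (y + a)) := by
  have := hg.shift_int hd x (-a)
  simpa using this

lemma slideT {d : ℝ} (hd : 1 < d) {f g : ℝ → ℝ} (hf : Sol d f) (hg : Sol d g) {a M : ℝ}
    (h : ∀ y, M ≤ y → g (y + a) ≤ f y) {x : ℝ} (hx : x ≤ -M) : f x ≤ g (x - a) := by
  rw [hf.le_iff hg, AA_shift']
  apply integral_mono (hg.good.shift_int' hd x a) (hf.good.integrable hd x)
  intro y
  simp only
  by_cases hy : x + y ≤ 0
  · rw [kk_of_nonpos hd hy]; simp
  · exact mul_le_mul_of_nonneg_left (h y (by linarith)) (kk_nonneg hd _)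

lemma symm_of {d : ℝ} (hd : 1 < d) {f g : ℝ → ℝ} (hf : Sol d f) (hg : Sol d g) {a : ℝ}
    (h : ∀ x, f x ≤ g (x - a)) (x : ℝ) : g x ≤ f (x - a) := by
  apply slideT hd hg hf (M := -x) _ (by linarith)
  intro y _
  simpa using h (y + a)

lemma Good.AA_upper {d : ℝ} (hd : 1 < d) {g : ℝ → ℝ} (hg : Good d g) {z : ℝ} (hz : 0 ≤ z) :
    AA d g z ≤ z ^ d + 2 ^ (d - 1) * (kk d z * (∫ y in Ioi 0, GG d y)
      + ∫ y in Ioi 0, kk d y * GG d y) := by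
  have h1 : AA d g z = (∫ y in Iic 0, kk d (z + y) * g y) + ∫ y in Ioi 0, kk d (z + y) * g y := by
    have := integral_add_compl (measurableSet_Iic (a := (0:ℝ))) (hg.integrable hd z)
    rw [compl_Iic] at this
    exact this.symm
  have h2 : ∫ y in Iic 0, kk d (z + y) * g y ≤ z ^ d := by
    rw [← kk_integral_Iic hd hz]
    apply setIntegral_mono (hg.integrable hd z).integrableOn (kk_add_integrableOn hd z)
    intro y
    exact mul_le_of_le_one_right (kk_nonneg hd _) (hg.le_one y)
  have h3 : ∫ y in Ioi 0, kk d (z + y) * g y ≤ 2 ^ (d - 1) * (kk d z * (∫ y in Ioi 0, GG d y)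
      + ∫ y in Ioi 0, kk d y * GG d y) := by
    rw [← integral_const_mul, ← integral_add ((GG_integrableOn hd).const_mul _)
      (kG_integrableOn hd), ← integral_const_mul]
    apply setIntegral_mono (hg.integrable hd z).integrableOn
    · exact (((GG_integrableOn hd).const_mul (kk d z)).add (kG_integrableOn hd)).const_mul _
    intro y
    simp only
    calc kk d (z + y) * g y ≤ 2 ^ (d - 1) * (kk d z + kk d y) * GG d y := by
          apply mul_le_mul (kk_add_le hd z y) (hg.decay y) (hg.nonneg y)
          have := kk_nonneg hd z
          have := kk_nonneg hd y
          positivity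
      _ = _ := by ring
  linarith

lemma Sol.one_sub_le {d : ℝ} (hd : 1 < d) {f : ℝ → ℝ} (hf : Sol d f) {s : ℝ} (hs : 0 ≤ s) :
    1 - f (-s) ≤ Real.exp 1 * GG d s := by
  have h1 := hf.good.AA_neg hd hs
  have h2 := Real.add_one_le_exp (-AA d f (-s))
  rw [← hf.eq] at h2
  linarith

lemma GG_neg_integrableOn {d : ℝ} (hd : 1 < d) : IntegrableOn (fun y => GG d (-y)) (Iic 0) := by
  have h := GG_integrableOn hd
  rw [← integrableOn_Ici_iff_integrableOn_Ioi] at h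
  have h2 := (integrable_indicator_iff measurableSet_Ici).2 h
  have h3 := h2.comp_neg
  rw [← integrable_indicator_iff measurableSet_Iic]
  refine h3.congr (Eventually.of_forall fun y => ?_)
  by_cases hy : y ≤ 0
  · simp [indicator, hy]
  · simp [indicator, hy]

lemma Sol.AA_lower {d : ℝ} (hd : 1 < d) {f : ℝ → ℝ} (hf : Sol d f) {x : ℝ} (hx : 0 ≤ x) :
    x ^ d - kk d x * (Real.exp 1 * ∫ y in Iic 0, GG d (-y)) ≤ AA d f x := by
  have h1 : ∫ y in Iic 0, kk d (x + y) * f y ≤ AA d f x := by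
    apply setIntegral_le_integral (hf.good.integrable hd x)
    exact Eventually.of_forall fun y => mul_nonneg (kk_nonneg hd _) (hf.good.nonneg y)
  refine le_trans ?_ h1
  rw [← kk_integral_Iic hd hx, ← integral_const_mul, ← integral_const_mul, ← integral_sub
    (kk_add_integrableOn hd x) (((GG_neg_integrableOn hd).const_mul _).const_mul _)]
  apply setIntegral_mono_on _ (hf.good.integrable hd x).integrableOn measurableSet_Iic
  · intro y hy
    have hy' : y ≤ 0 := hy
    have e1 := hf.one_sub_le hd (s := -y) (by linarith)
    rw [neg_neg] at e1
    have e2 : kk d (x + y) ≤ kk d x := kk_mono hd (by linarith)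
    have e3 := kk_nonneg hd (x + y)
    have e4 := @GG_pos d (-y)
    have : kk d (x + y) * (1 - f y) ≤ kk d x * (Real.exp 1 * GG d (-y)) := by
      apply mul_le_mul e2 e1
      · linarith [hf.good.le_one y]
      · exact kk_nonneg hd x
    linarith
  · exact (kk_add_integrableOn hd x).sub (((GG_neg_integrableOn hd).const_mul _).const_mul _)

lemma far {d : ℝ} (hd : 1 < d) {f g : ℝ → ℝ} (hf : Sol d f) (hg : Sol d g) :
    ∃ a M : ℝ, ∀ x, M ≤ x → f x ≤ g (x - a) := by
  have hC0 : 0 ≤ ∫ y in Ioi 0, GG d y := integral_nonneg fun y => GG_pos.le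
  have hC1 : 0 ≤ ∫ y in Ioi 0, kk d y * GG d y :=
    integral_nonneg fun y => mul_nonneg (kk_nonneg hd y) GG_pos.le
  have hP : 0 ≤ ∫ y in Iic 0, GG d (-y) := integral_nonneg fun y => GG_pos.le
  have hU := fun z hz => hg.good.AA_upper hd (z := z) hz
  have hL := fun z hz => hf.AA_lower hd (x := z) hz
  generalize (∫ y in Ioi 0, GG d y) = C0 at *
  generalize (∫ y in Ioi 0, kk d y * GG d y) = C1 at *
  generalize (∫ y in Iic 0, GG d (-y)) = P at *
  have hB : (0:ℝ) < 2 ^ (d - 1) := by positivity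
  generalize (2:ℝ) ^ (d - 1) = B at *
  have he := Real.exp_pos 1
  generalize Real.exp 1 = e at *
  have ha0 : 0 ≤ B * (d * C0 + C1) + d * (e * P) := by positivity
  refine ⟨B * (d * C0 + C1) + d * (e * P), max 1 (B * (d * C0 + C1) + d * (e * P)), ?_⟩
  generalize ha : B * (d * C0 + C1) + d * (e * P) = a at *
  intro x hx
  have hx1 : 1 ≤ x := (le_max_left _ _).trans hx
  have hx2 : a ≤ x := (le_max_right _ _).trans hx
  rw [hf.le_iff hg]
  refine (hU _ (by linarith)).trans (le_trans ?_ (hL x (by linarith)))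
  have e1 : ∀ y : ℝ, 0 ≤ y → y ^ d = y ^ (d - 1) * y := by
    intro y hy
    rw [← Real.rpow_add_one' hy (by linarith), sub_add_cancel]
  have e2 : (x - a) ^ (d - 1) ≤ x ^ (d - 1) :=
    Real.rpow_le_rpow (by linarith) (by linarith) (by linarith)
  have e3 : 1 ≤ x ^ (d - 1) := Real.one_le_rpow hx1 (by linarith)
  rw [e1 _ (by linarith : 0 ≤ x - a), e1 _ (by linarith : 0 ≤ x), kk_of_nonneg (by linarith),
    kk_of_nonneg (by linarith)]
  have e4 : (x - a) ^ (d - 1) * (x - a) ≤ x ^ (d - 1) * (x - a) :=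
    mul_le_mul_of_nonneg_right e2 (by linarith)
  have e5 : B * (d * (x - a) ^ (d - 1) * C0 + C1) ≤ B * (d * x ^ (d - 1) * C0 + x ^ (d - 1) * C1) := by
    apply mul_le_mul_of_nonneg_left _ hB.le
    have : d * (x - a) ^ (d - 1) * C0 ≤ d * x ^ (d - 1) * C0 := by gcongr
    have : 1 * C1 ≤ x ^ (d - 1) * C1 := by gcongr
    linarith
  have e6 : B * (d * x ^ (d - 1) * C0 + x ^ (d - 1) * C1) + d * x ^ (d - 1) * (e * P)
      = x ^ (d - 1) * a := by
    rw [← ha]; ring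
  linarith

lemma Sol.lt_one {d : ℝ} (hd : 1 < d) {f : ℝ → ℝ} (hf : Sol d f) (x : ℝ) : f x < 1 := by
  rw [hf.eq, Real.exp_lt_one_iff, neg_lt_zero]
  unfold AA
  apply integral_pos_of_integrable_nonneg_nonzero (x := -x + 1) _ (hf.good.integrable hd x)
  · exact fun y => mul_nonneg (kk_nonneg hd _) (hf.good.nonneg y)
  · have := kk_pos hd (s := x + (-x + 1)) (by simp)
    have := hf.pos (-x + 1)
    positivity
  · exact ((kk_cont hd).comp (by fun_prop)).mul (hf.cont hd)

lemma Sol.tendsto_atBot {d : ℝ} (hd : 1 < d) {f : ℝ → ℝ} (hf : Sol d f) :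
    Tendsto f atBot (nhds 1) := by
  have h1 : Tendsto (fun s => GG d s) atTop (nhds 0) := by
    have := (exp_tendsto hd (Real.exp_pos (-1))).neg
    rw [neg_zero] at this
    refine this.congr' ?_
    filter_upwards [eventually_ge_atTop 0] with s hs
    rw [GG_of_nonneg hs, neg_neg]
  have h2 : Tendsto (fun s => 1 - Real.exp 1 * GG d (-s)) atBot (nhds 1) := by
    have := ((h1.comp tendsto_neg_atBot_atTop).const_mul (Real.exp 1)).const_sub 1
    simpa using this
  apply tendsto_of_tendsto_of_tendsto_of_le_of_le' h2 tendsto_const_nhds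
  · filter_upwards [eventually_le_atBot 0] with s hs
    have := hf.one_sub_le hd (s := -s) (by linarith)
    rw [neg_neg] at this
    linarith
  · exact Eventually.of_forall fun s => hf.good.le_one s

lemma glob {d : ℝ} (hd : 1 < d) {f g : ℝ → ℝ} (hf : Sol d f) (hg : Sol d g) {a M : ℝ}
    (ha : 0 ≤ a) (h1 : ∀ x, M ≤ x → f x ≤ g (x - a)) (h2 : ∀ x, M ≤ x → g x ≤ f (x - a))
    (h3 : ∀ x ∈ Icc (-M) M, f x ≤ g (x - a)) (x : ℝ) : f x ≤ g (x - a) := by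
  rcases le_total M x with h | h
  · exact h1 x h
  · rcases le_total x (-M) with h' | h'
    · apply slideT hd hf hg (M := M) _ h'
      intro y hy
      have := h2 (y + a) (by linarith)
      simpa using this
    · exact h3 x ⟨h', h⟩

lemma exists_shift {d : ℝ} (hd : 1 < d) {f g : ℝ → ℝ} (hf : Sol d f) (hg : Sol d g) :
    ∃ a : ℝ, 0 ≤ a ∧ ∀ x, f x ≤ g (x - a) := by
  obtain ⟨a1, M1, h1⟩ := far hd hf hg
  obtain ⟨a2, M2, h2⟩ := far hd hg hf
  obtain ⟨N, hN⟩ := eventually_atBot.1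
    ((hg.tendsto_atBot hd).eventually (lt_mem_nhds (hf.lt_one hd (-(max M1 M2)))))
  set M := max M1 M2
  refine ⟨max 0 (max (max a1 a2) (M - N)), le_max_left _ _, ?_⟩
  set a := max 0 (max (max a1 a2) (M - N)) with ha
  have b0 : 0 ≤ a := le_max_left _ _
  have b1 : a1 ≤ a := (le_max_left _ _).trans ((le_max_left _ _).trans (le_max_right _ _))
  have b2 : a2 ≤ a := (le_max_right _ _).trans ((le_max_left _ _).trans (le_max_right _ _))
  have b3 : M - N ≤ a := (le_max_right _ _).trans (le_max_right _ _)
  apply glob hd hf hg b0 (M := M)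
  · intro x hx
    exact (h1 x ((le_max_left _ _).trans hx)).trans (hg.good.anti (by linarith))
  · intro x hx
    exact (h2 x ((le_max_right _ _).trans hx)).trans (hf.good.anti (by linarith))
  · intro x hx
    have := hN (x - a) (by linarith [hx.2])
    exact (hf.good.anti hx.1).trans this.le

/-- The increments of an antitone [0,1]-valued function -/
lemma incr {d : ℝ} {g : ℝ → ℝ} (hg : Good d g) {e : ℝ} (he : 0 ≤ e) :
    Integrable (fun y => g (y - e) - g y) ∧ ∫ y, (g (y - e) - g y) ≤ e := by
  have hi : ∀ a b, IntervalIntegrable g volume a b := fun a b => hg.anti.intervalIntegrable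
  have hi2 : ∀ a b, IntervalIntegrable (fun y => g (y - e)) volume a b := fun a b =>
    Antitone.intervalIntegrable fun x y hxy => hg.anti (by linarith)
  have hb : ∀ n : ℕ, ∫ y in (-(n:ℝ))..n, (g (y - e) - g y) ≤ e := by
    intro n
    rw [intervalIntegral.integral_sub (hi2 _ _) (hi _ _), intervalIntegral.integral_comp_sub_right,
      intervalIntegral.integral_interval_sub_interval_comm (hi _ _) (hi _ _) (hi _ _)]
    have h1 : ∫ x in (-(n:ℝ) - e)..(-n), g x ≤ ∫ x in (-(n:ℝ) - e)..(-n), (1:ℝ) := by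
      apply intervalIntegral.integral_mono_on (by linarith) (hi _ _) (by simp)
      intro x _
      exact hg.le_one x
    have h2 : 0 ≤ ∫ x in ((n:ℝ) - e)..n, g x :=
      intervalIntegral.integral_nonneg (by linarith) fun x _ => hg.nonneg x
    simp at h1
    linarith
  have t1 : Tendsto (fun n : ℕ => -(n:ℝ)) atTop atBot :=
    tendsto_neg_atTop_atBot.comp tendsto_natCast_atTop_atTop
  have hnn : ∀ y, 0 ≤ g (y - e) - g y := fun y => sub_nonneg.2 (hg.anti (by linarith))
  have I : Integrable (fun y => g (y - e) - g y) := by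
    apply integrable_of_intervalIntegral_norm_bounded e _ t1 tendsto_natCast_atTop_atTop
    · refine Eventually.of_forall fun n => ?_
      simp only [Real.norm_of_nonneg (hnn _)]
      exact hb n
    · intro n
      exact ((hi2 _ _).sub (hi _ _)).1
  refine ⟨I, ?_⟩
  exact le_of_tendsto (intervalIntegral_tendsto_integral I t1 tendsto_natCast_atTop_atTop)
    (Eventually.of_forall hb)

lemma AA_incr {d : ℝ} (hd : 1 < d) {g : ℝ → ℝ} (hg : Good d g) {e : ℝ} (he : 0 ≤ e) :
    ∃ C, ∀ z, AA d g (z + e) - AA d g z ≤ 2 ^ (d - 1) * (kk d z * e + C) := by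
  obtain ⟨I, hI⟩ := incr hg he
  have I2 : Integrable (fun y => kk d y * g (y - e)) := by
    simpa using hg.shift_int hd 0 e
  refine ⟨∫ y, kk d y * g (y - e), fun z => ?_⟩
  rw [AA_shift]
  unfold AA
  rw [← integral_sub (hg.shift_int hd z e) (hg.integrable hd z)]
  have h1 : 2 ^ (d - 1) * (kk d z * (∫ y, (g (y - e) - g y)) + ∫ y, kk d y * g (y - e)) ≤
      2 ^ (d - 1) * (kk d z * e + ∫ y, kk d y * g (y - e)) := by
    have := kk_nonneg hd z
    gcongr
  refine le_trans ?_ h1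
  rw [← integral_const_mul, ← integral_add (I.const_mul _) I2, ← integral_const_mul]
  apply integral_mono ((hg.shift_int hd z e).sub (hg.integrable hd z))
  · exact ((I.const_mul _).add I2).const_mul _
  · intro y
    simp only [Pi.sub_apply]
    have hnn : 0 ≤ g (y - e) - g y := sub_nonneg.2 (hg.anti (by linarith))
    have e1 := mul_le_mul_of_nonneg_right (kk_add_le hd z y) hnn
    have e2 : kk d y * (g (y - e) - g y) ≤ kk d y * g (y - e) :=
      mul_le_mul_of_nonneg_left (by linarith [hg.nonneg y]) (kk_nonneg hd y)
    have hB : (0:ℝ) < 2 ^ (d - 1) := by positivity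
    have e3 := mul_le_mul_of_nonneg_left e2 hB.le
    linarith

lemma margin {d : ℝ} (hd : 1 < d) {f g : ℝ → ℝ} (hf : Sol d f) (hg : Sol d g) {a : ℝ}
    (ha : 0 ≤ a) (hw : ∀ y, g (y + a) < f y) :
    ∃ e M : ℝ, 0 < e ∧ ∀ x, M ≤ x → f x ≤ g (x - (a - e)) := by
  -- lower bound for w on [0,1]
  obtain ⟨y0, -, hy0⟩ := isCompact_Icc.exists_isMinOn (s := Icc (0:ℝ) 1) ⟨0, by simp⟩
    (f := fun y => f y - g (y + a))
    ((hf.cont hd).sub ((hg.cont hd).comp (by fun_prop))).continuousOn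
  set η := f y0 - g (y0 + a) with hη
  have hη0 : 0 < η := sub_pos.2 (hw y0)
  have hη1 : ∀ y ∈ Icc (0:ℝ) 1, η ≤ f y - g (y + a) := fun y hy => hy0 hy
  have hδ : ∀ x, AA d g (x - a) + η * kk d x ≤ AA d f x := by
    intro x
    have i1 : Integrable ((Icc (0:ℝ) 1).indicator (fun _ => η * kk d x)) := by
      rw [integrable_indicator_iff measurableSet_Icc]
      exact integrableOn_const (by simp)
    have e1 : ∫ y, (Icc (0:ℝ) 1).indicator (fun _ => η * kk d x) y = η * kk d x := by
      rw [integral_indicator measurableSet_Icc]; simp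
    rw [AA_shift', ← e1, ← integral_add (hg.good.shift_int' hd x a) i1]
    apply integral_mono ((hg.good.shift_int' hd x a).add i1) (hf.good.integrable hd x)
    intro y
    simp only [Pi.add_apply]
    by_cases hy : y ∈ Icc (0:ℝ) 1
    · rw [indicator_of_mem hy]
      have e2 : kk d x ≤ kk d (x + y) := kk_mono hd (by linarith [hy.1])
      have e3 := hη1 y hy
      have := mul_le_mul e3 e2 (kk_nonneg hd x) (by linarith)
      linarith
    · rw [indicator_of_notMem hy, add_zero]
      exact mul_le_mul_of_nonneg_left (hw y).le (kk_nonneg hd _)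
  have hB : (0:ℝ) < 2 ^ (d - 1) := by positivity
  set B : ℝ := 2 ^ (d - 1)
  set e := η / (2 * B) with he
  have he0 : 0 < e := by positivity
  obtain ⟨C, hC⟩ := AA_incr hd hg.good he0.le
  have ht : Tendsto (fun x : ℝ => d * x ^ (d - 1)) atTop atTop :=
    (tendsto_rpow_atTop (by linarith)).const_mul_atTop (by linarith)
  obtain ⟨M, hM⟩ := eventually_atTop.1 (ht.eventually_ge_atTop (2 * (B * C) / η))
  refine ⟨e, max M 0, he0, fun x hx => ?_⟩
  have hx0 : 0 ≤ x := (le_max_right _ _).trans hx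
  have h1 := hM x ((le_max_left _ _).trans hx)
  rw [← kk_of_nonneg hx0, div_le_iff₀ hη0] at h1
  rw [hf.le_iff hg]
  have h2 := hC (x - a)
  have h3 := hδ x
  have h4 : kk d (x - a) ≤ kk d x := kk_mono hd (by linarith)
  have h5 : B * e = η / 2 := by rw [he]; field_simp
  have h6 : B * (kk d (x - a) * e + C) = kk d (x - a) * (η / 2) + B * C := by rw [← h5]; ring
  have h7 : kk d (x - a) * (η / 2) ≤ kk d x * (η / 2) := by gcongr
  rw [show x - (a - e) = x - a + e by ring]
  linarith

lemma strict {d : ℝ} (hd : 1 < d) {f g : ℝ → ℝ} (hf : Sol d f) (hg : Sol d g) {a x y0 : ℝ}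
    (hw : ∀ y, g (y + a) ≤ f y) (h0 : g (y0 + a) < f y0) (hx : 0 < x + y0) : f x < g (x - a) := by
  rw [hf.lt_iff hg, AA_shift', ← sub_pos]
  unfold AA
  rw [← integral_sub (hf.good.integrable hd x) (hg.good.shift_int' hd x a)]
  apply integral_pos_of_integrable_nonneg_nonzero (x := y0)
  · have hk : Continuous fun y => kk d (x + y) := (kk_cont hd).comp (by fun_prop)
    exact (hk.mul (hf.cont hd)).sub (hk.mul ((hg.cont hd).comp (by fun_prop)))
  · exact (hf.good.integrable hd x).sub (hg.good.shift_int' hd x a)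
  · intro y
    exact sub_nonneg.2 (mul_le_mul_of_nonneg_left (hw y) (kk_nonneg hd _))
  · have := kk_pos hd hx
    apply ne_of_gt
    exact sub_pos.2 (mul_lt_mul_of_pos_left h0 this)

lemma nondeg {d : ℝ} (hd : 1 < d) {f g : ℝ → ℝ} (hf : Sol d f) (hg : Sol d g) {a : ℝ}
    (ha : 0 < a) (hw : ∀ y, g (y + a) ≤ f y) : ∃ y0, g (y0 + a) < f y0 := by
  by_contra! hcon
  have h1 : ∀ y, f y = g (y + a) := fun y => le_antisymm (hcon y) (hw y)
  have h2 : ∀ x, AA d g (x - a) = AA d f x := by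
    intro x
    rw [AA_shift']
    simp only [← h1]
    rfl
  have h3 : g (-a) = g a := by
    have e1 := h1 0
    have e2 := h2 0
    rw [zero_sub] at e2
    rw [hg.eq (-a), e2, ← hf.eq, e1, zero_add]
  have h4 : AA d g (-a) < AA d g a := by
    rw [← sub_pos]
    unfold AA
    rw [← integral_sub (hg.good.integrable hd _) (hg.good.integrable hd _)]
    have hk : ∀ x, Continuous fun y => kk d (x + y) := fun x => (kk_cont hd).comp (by fun_prop)
    apply integral_pos_of_integrable_nonneg_nonzero (x := 0)
    · exact ((hk _).mul (hg.cont hd)).sub ((hk _).mul (hg.cont hd))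
    · exact (hg.good.integrable hd _).sub (hg.good.integrable hd _)
    · intro y
      exact sub_nonneg.2 (mul_le_mul_of_nonneg_right (kk_mono hd (by linarith)) (hg.good.nonneg y))
    · apply ne_of_gt
      have e1 := kk_pos hd ha
      have e2 := kk_of_nonpos hd (s := -a) (by linarith)
      have e3 := hg.pos 0
      rw [add_zero, add_zero, e2, zero_mul, sub_zero]
      positivity
  rw [← hg.lt_iff hg] at h4
  exact absurd h3 h4.ne'

lemma improve {d : ℝ} (hd : 1 < d) {f g : ℝ → ℝ} (hf : Sol d f) (hg : Sol d g) {a : ℝ}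
    (ha : 0 < a) (h : ∀ x, f x ≤ g (x - a)) : ∃ b, 0 ≤ b ∧ b < a ∧ ∀ x, f x ≤ g (x - b) := by
  have h' := symm_of hd hf hg h
  have hw : ∀ y, g (y + a) ≤ f y := fun y => by simpa using h' (y + a)
  have hw' : ∀ y, f (y + a) ≤ g y := fun y => by simpa using h (y + a)
  obtain ⟨y0, hy0⟩ := nondeg hd hf hg ha hw
  -- strictness
  have s1 : f (-y0 + 1) < g (-y0 + 1 - a) := strict hd hf hg hw hy0 (by simp)
  have s2 : ∀ y, g (y + a) < f y := by
    intro y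
    set z := max (-y0 + 1) (-y + 1) with hz
    have hz1 : -y0 + 1 ≤ z := le_max_left _ _
    have hz2 : -y + 1 ≤ z := le_max_right _ _
    have s3 : f z < g (z - a) := strict hd hf hg hw hy0 (by linarith)
    have := strict hd hg hf (a := a) (x := y + a) (y0 := z - a) hw' (by simpa using s3) (by linarith)
    simpa using this
  have s4 : ∀ x, f x < g (x - a) := fun x => strict hd hf hg (y0 := -x + 1) hw (s2 _) (by simp)
  have s5 : ∀ y, f (y + a) < g y := fun y => by simpa using s4 (y + a)
  obtain ⟨e1, M1, he1, hM1⟩ := margin hd hf hg ha.le s2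
  obtain ⟨e2, M2, he2, hM2⟩ := margin hd hg hf ha.le s5
  set M := max M1 M2
  have mid : ∀ᶠ e in nhds (0:ℝ), ∀ x ∈ Icc (-M) M, f x < g (x - (a - e)) := by
    apply isCompact_Icc.eventually_forall_of_forall_eventually
      (P := fun e x => f x < g (x - (a - e)))
    intro x _
    have c1 : Continuous fun z : ℝ × ℝ => f z.2 := (hf.cont hd).comp continuous_snd
    have c2 : Continuous fun z : ℝ × ℝ => g (z.2 - (a - z.1)) := (hg.cont hd).comp (by fun_prop)
    apply c1.continuousAt.eventually_lt c2.continuousAt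
    simpa using s4 x
  obtain ⟨r, hr, hmid⟩ := Metric.eventually_nhds_iff.1 mid
  set e := min (min e1 e2) (min a (r / 2)) with he
  have f1 : e ≤ e1 := (min_le_left _ _).trans (min_le_left _ _)
  have f2 : e ≤ e2 := (min_le_left _ _).trans (min_le_right _ _)
  have f3 : e ≤ a := (min_le_right _ _).trans (min_le_left _ _)
  have f4 : e ≤ r / 2 := (min_le_right _ _).trans (min_le_right _ _)
  have f5 : 0 < e := lt_min (lt_min he1 he2) (lt_min ha (by linarith))
  refine ⟨a - e, by linarith, by linarith, ?_⟩
  apply glob hd hf hg (by linarith) (M := M)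
  · intro x hx
    exact (hM1 x ((le_max_left _ _).trans hx)).trans (hg.good.anti (by linarith))
  · intro x hx
    exact (hM2 x ((le_max_right _ _).trans hx)).trans (hf.good.anti (by linarith))
  · intro x hx
    refine (hmid (y := e) ?_ x hx).le
    rw [Real.dist_eq, sub_zero, abs_of_pos f5]
    linarith

lemma unique {d : ℝ} (hd : 1 < d) {f g : ℝ → ℝ} (hf : Sol d f) (hg : Sol d g) : f = g := by
  set S := {a : ℝ | 0 ≤ a ∧ ∀ x, f x ≤ g (x - a)} with hS
  have hne : S.Nonempty := exists_shift hd hf hg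
  have hbd : BddBelow S := ⟨0, fun a ha => ha.1⟩
  have hcl : IsClosed S := by
    apply IsClosed.inter (isClosed_le continuous_const continuous_id)
    have : {a : ℝ | ∀ x, f x ≤ g (x - a)} = ⋂ x, {a : ℝ | f x ≤ g (x - a)} := by
      ext; simp
    change IsClosed {a : ℝ | ∀ x, f x ≤ g (x - a)}
    rw [this]
    exact isClosed_iInter fun x => isClosed_le continuous_const ((hg.cont hd).comp (by fun_prop))
  have hmem := hcl.csInf_mem hne hbd
  have h0 : sInf S = 0 := by
    by_contra hne0
    have hpos : 0 < sInf S := lt_of_le_of_ne hmem.1 (Ne.symm hne0)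
    obtain ⟨b, hb0, hb1, hb⟩ := improve hd hf hg hpos hmem.2
    have := csInf_le hbd (show b ∈ S from ⟨hb0, hb⟩)
    linarith
  rw [h0] at hmem
  have h1 := hmem.2
  have h2 := symm_of hd hf hg h1
  simp only [sub_zero] at h1 h2
  exact funext fun x => le_antisymm (h1 x) (h2 x)

end MP
namespace MP

lemma helly {d : ℝ} {Fn : ℕ → ℝ → ℝ} (hG : ∀ n, Good d (Fn n)) :
    ∃ φ : ℕ → ℕ, StrictMono φ ∧ ∃ f0 : ℝ → ℝ,
      ∀ᵐ y, Tendsto (fun n => Fn (φ n) y) atTop (nhds (f0 y)) := by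
  obtain ⟨l, φ, hφ, hl⟩ := CompactSpace.tendsto_subseq
    (fun n => (fun q : ℚ => (⟨Fn n q, (hG n).nonneg _, (hG n).le_one _⟩ : Icc (0:ℝ) 1)))
  rw [tendsto_pi_nhds] at hl
  have hl' : ∀ q : ℚ, Tendsto (fun n => Fn (φ n) q) atTop (nhds (l q : ℝ)) := by
    intro q
    exact (continuous_subtype_val.tendsto _).comp (hl q)
  set f0 : ℝ → ℝ := fun x => limsup (fun n => Fn (φ n) x) atTop with hf0
  have hq : ∀ q : ℚ, f0 q = l q := fun q => (hl' q).limsup_eq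
  have hanti : Antitone f0 := by
    intro x y hxy
    apply limsup_le_limsup
    · exact Eventually.of_forall fun n => (hG _).anti hxy
    · exact isCoboundedUnder_le_of_le atTop (x := 0) fun n => (hG _).nonneg _
    · exact isBoundedUnder_of ⟨1, fun n => (hG _).le_one _⟩
  refine ⟨φ, hφ, f0, ?_⟩
  have hc := hanti.countable_not_continuousAt
  have hae : ∀ᵐ y, ContinuousAt f0 y := by
    have := hc.measure_zero volume
    exact this
  filter_upwards [hae] with y hy
  rw [tendsto_order]
  constructor
  · intro b hb
    have h1 : ∀ᶠ z in nhds y, b < f0 z := hy.eventually (lt_mem_nhds hb)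
    obtain ⟨r, hr, h2⟩ := Metric.eventually_nhds_iff.1 h1
    obtain ⟨q, hq1, hq2⟩ := exists_rat_btwn (show y < y + r by linarith)
    have h3 : b < f0 q := h2 (by rw [Real.dist_eq, abs_of_pos (by linarith)]; linarith)
    rw [hq] at h3
    filter_upwards [(hl' q).eventually (lt_mem_nhds h3)] with n hn
    exact hn.trans_le ((hG _).anti hq1.le)
  · intro b hb
    have h1 : ∀ᶠ z in nhds y, f0 z < b := hy.eventually (gt_mem_nhds hb)
    obtain ⟨r, hr, h2⟩ := Metric.eventually_nhds_iff.1 h1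
    obtain ⟨q, hq1, hq2⟩ := exists_rat_btwn (show y - r < y by linarith)
    have h3 : f0 q < b := h2 (by rw [Real.dist_eq, abs_of_neg (by linarith)]; linarith)
    rw [hq] at h3
    filter_upwards [(hl' q).eventually (gt_mem_nhds h3)] with n hn
    exact ((hG _).anti hq2.le).trans_lt hn

lemma AA_tendsto {d : ℝ} (hd : 1 < d) {Fn : ℕ → ℝ → ℝ} (hG : ∀ n, Good d (Fn n)) {f0 : ℝ → ℝ}
    (h : ∀ᵐ y, Tendsto (fun n => Fn n y) atTop (nhds (f0 y))) (x : ℝ) :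
    Tendsto (fun n => AA d (Fn n) x) atTop (nhds (AA d f0 x)) := by
  unfold AA
  apply tendsto_integral_filter_of_dominated_convergence (fun y => kk d (x + y) * GG d y)
  · exact Eventually.of_forall fun n => (hG n).meas hd x
  · exact Eventually.of_forall fun n => Eventually.of_forall fun y => (hG n).bound hd x y
  · exact kkG_integrable hd x
  · filter_upwards [h] with y hy
    exact hy.const_mul _

lemma limitSol {d : ℝ} (hd : 1 < d) {Fn : ℕ → ℝ → ℝ} (hG : ∀ n, Good d (Fn n))
    (he : ∀ x, ∀ᶠ n in atTop, Fn n x = Real.exp (-AA d (Fn n) x)) :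
    ∃ φ : ℕ → ℕ, StrictMono φ ∧ ∃ f : ℝ → ℝ, Sol d f ∧
      ∀ y, Tendsto (fun n => Fn (φ n) y) atTop (nhds (f y)) := by
  obtain ⟨φ, hφ, f0, hf0⟩ := helly hG
  have key : ∀ f1 : ℝ → ℝ, (∀ᵐ y, Tendsto (fun n => Fn (φ n) y) atTop (nhds (f1 y))) →
      ∀ x, Tendsto (fun n => Fn (φ n) x) atTop (nhds (Real.exp (-AA d f1 x))) := by
    intro f1 h1 x
    have h2 := AA_tendsto hd (fun n => hG (φ n)) h1 x
    have h3 := (Real.continuous_exp.tendsto _).comp h2.neg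
    refine h3.congr' ?_
    filter_upwards [hφ.tendsto_atTop.eventually (he x)] with n hn
    exact hn.symm
  have h1 := key f0 hf0
  refine ⟨φ, hφ, fun x => Real.exp (-AA d f0 x), ⟨⟨?_, ?_, ?_⟩, ?_⟩, h1⟩
  · intro x y hxy
    exact le_of_tendsto_of_tendsto' (h1 y) (h1 x) fun n => (hG _).anti hxy
  · intro y
    exact (Real.exp_pos _).le
  · intro y
    exact le_of_tendsto' (h1 y) fun n => (hG _).decay y
  · intro x
    exact tendsto_nhds_unique (h1 x) (key _ (Eventually.of_forall h1) x)

lemma ker_eq {d : ℝ} (hd : 1 < d) (h : ℝ → ℝ) (x : ℝ) :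
    (fun y => kk d (x + y) * h y) =
      (Ioi (-x)).indicator (fun y => d * ((x + y) ^ (d - 1) * h y)) := by
  ext y
  by_cases hy : -x < y
  · rw [indicator_of_mem (show y ∈ Ioi (-x) from hy), kk_of_nonneg (by linarith)]
    ring
  · rw [indicator_of_notMem (show y ∉ Ioi (-x) from hy), kk_of_nonpos hd (by linarith), zero_mul]

lemma AA_eq {d : ℝ} (hd : 1 < d) (h : ℝ → ℝ) (x : ℝ) :
    AA d h x = d * ∫ y in Ioi (-x), (x + y) ^ (d - 1) * h y := by
  unfold AA
  rw [ker_eq hd, integral_indicator measurableSet_Ioi, integral_const_mul]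

lemma int_iff {d : ℝ} (hd : 1 < d) (h : ℝ → ℝ) (x : ℝ) :
    Integrable (fun y => kk d (x + y) * h y) ↔
      IntegrableOn (fun y => (x + y) ^ (d - 1) * h y) (Ioi (-x)) := by
  rw [ker_eq hd, integrable_indicator_iff measurableSet_Ioi]
  exact integrable_const_mul_iff (isUnit_iff_ne_zero.2 (by linarith)) _

lemma Sol.solves {d : ℝ} (hd : 1 < d) {f : ℝ → ℝ} (hf : Sol d f) : SolvesCavity d f := by
  refine ⟨hf.good.anti.measurable, fun x => ⟨hf.good.nonneg x, hf.good.le_one x⟩, ?_, ?_⟩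
  · intro x
    exact (int_iff hd f x).1 (hf.good.integrable hd x)
  · intro x
    rw [← AA_eq hd]
    exact hf.eq x

lemma Sol.of_solves {d : ℝ} (hd : 1 < d) {f : ℝ → ℝ} (ha : Antitone f) (hf : SolvesCavity d f) :
    Sol d f := by
  obtain ⟨-, h1, h2, h3⟩ := hf
  have h4 : ∀ x, f x = Real.exp (-AA d f x) := by
    intro x
    rw [AA_eq hd]
    exact h3 x
  refine ⟨decay hd ha (fun y => (h1 y).1) (fun y => (h1 y).2) (fun x => (int_iff hd f x).2 (h2 x))
    (h4 0) fun y _ => (h4 y).le, h4⟩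

lemma ext_good {d : ℝ} (hd : 1 < d) {lam : ℝ} (hl : 0 < lam) {f : ℝ → ℝ}
    (hf : ExtFixedPoint d lam f) :
    Good d f ∧ ∀ x ∈ Icc (-lam) lam, f x = Real.exp (-AA d f x) := by
  obtain ⟨h1, h2, h3, h4, h5⟩ := hf
  have hr : ∀ x, f x ∈ Icc (0:ℝ) 1 := by
    intro x
    rcases le_total x (-lam) with h | h
    · rw [h3 x h]; simp
    · rcases le_or_gt x lam with h' | h'
      · exact h2 x ⟨h, h'⟩
      · rw [h4 x h']; simp
  have ha : Antitone f := by
    intro x y hxy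
    rcases le_total x (-lam) with h | h
    · rw [h3 x h]; exact (hr y).2
    · rcases le_or_gt y lam with h' | h'
      · exact h1 ⟨h, hxy.trans h'⟩ ⟨h.trans hxy, h'⟩ hxy
      · rw [h4 y h']; exact (hr x).1
  have he : ∀ x ∈ Icc (-lam) lam, f x = Real.exp (-AA d f x) := by
    intro x hx
    rw [← h5 x hx, AA_eq hd]
    unfold T
    rw [intervalIntegral.integral_of_le (by linarith [hx.1])]
    congr 3
    symm
    apply setIntegral_eq_of_subset_of_forall_sdiff_eq_zero measurableSet_Ioi
    · exact fun y hy => hy.1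
    · intro y hy
      have hy1 : -x < y := hy.1
      have hy2 : lam < y := by
        by_contra hcon
        exact hy.2 ⟨hy1, not_lt.1 hcon⟩
      rw [h4 y hy2, mul_zero]
  have hi : ∀ x, Integrable (fun y => kk d (x + y) * f y) := by
    intro x
    have hc : Continuous fun y => kk d (x + y) := (kk_cont hd).comp (by fun_prop)
    have i1 : Integrable ((Icc (-x) lam).indicator fun y => kk d (x + y)) := by
      rw [integrable_indicator_iff measurableSet_Icc]
      exact hc.continuousOn.integrableOn_Icc
    apply i1.mono' (hc.measurable.mul ha.measurable).aestronglyMeasurable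
    refine Eventually.of_forall fun y => ?_
    have e1 := kk_nonneg hd (x + y)
    change ‖kk d (x + y) * f y‖ ≤ _
    rw [Real.norm_of_nonneg (mul_nonneg e1 (hr y).1)]
    by_cases hy : y ∈ Icc (-x) lam
    · rw [indicator_of_mem hy]
      exact mul_le_of_le_one_right e1 (hr y).2
    · rw [indicator_of_notMem hy]
      rcases le_or_gt y lam with h | h
      · have : y < -x := by
          by_contra hcon
          exact hy ⟨not_lt.1 hcon, h⟩
        rw [kk_of_nonpos hd (by linarith), zero_mul]
      · rw [h4 y h, mul_zero]
  refine ⟨decay hd ha (fun y => (hr y).1) (fun y => (hr y).2) hi (he 0 ⟨by linarith, hl.le⟩) ?_, he⟩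
  intro y hy
  rcases le_or_gt y lam with h | h
  · exact (he y ⟨by linarith, h⟩).le
  · rw [h4 y h]; exact (Real.exp_pos _).le

/-- bound for the entropy integrand -/
noncomputable def BB (d x : ℝ) : ℝ :=
  (Iic (0:ℝ)).indicator (fun x => Real.exp 1 * GG d (-x)) x +
    (Ioi (0:ℝ)).indicator (fun x => 2 * Real.exp (-(Real.exp (-1) / 2 * x ^ d))) x

lemma BB_integrable {d : ℝ} (hd : 1 < d) : Integrable (BB d) := by
  apply Integrable.add
  · rw [integrable_indicator_iff measurableSet_Iic]
    exact (GG_neg_integrableOn hd).const_mul _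
  · rw [integrable_indicator_iff measurableSet_Ioi]
    exact (exp_integrableOn hd (by positivity)).const_mul _

lemma ent_bound {d : ℝ} (hd : 1 < d) {lam : ℝ} (hl : 0 < lam) {f : ℝ → ℝ}
    (hf : ExtFixedPoint d lam f) (x : ℝ) : ‖f x * Real.log (f x)‖ ≤ BB d x := by
  obtain ⟨hg, he⟩ := ext_good hd hl hf
  have hlog : Real.log (f x) ≤ 0 := Real.log_nonpos (hg.nonneg x) (hg.le_one x)
  rw [norm_mul, Real.norm_of_nonneg (hg.nonneg x), Real.norm_of_nonpos hlog]
  unfold BB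
  rcases le_or_gt x 0 with hx | hx
  · rw [indicator_of_mem (show x ∈ Iic 0 from hx), indicator_of_notMem (by simpa using hx), add_zero]
    refine (mul_le_of_le_one_left (by linarith) (hg.le_one x)).trans ?_
    rcases le_total x (-lam) with h | h
    · rw [hf.2.2.1 x h, Real.log_one, neg_zero]
      have := @GG_pos d (-x)
      positivity
    · rw [he x ⟨h, by linarith⟩, Real.log_exp, neg_neg]
      have := hg.AA_neg hd (s := -x) (by linarith)
      rwa [neg_neg] at this
  · rw [indicator_of_notMem (by simpa using hx), indicator_of_mem (show x ∈ Ioi 0 from hx), zero_add]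
    have h1 : f x * -Real.log (f x) ≤ 2 * Real.sqrt (f x) := by
      rcases (hg.nonneg x).eq_or_lt with h | h
      · rw [← h]; simp
      · have hs : 0 < Real.sqrt (f x) := Real.sqrt_pos.2 h
        have hsq : Real.sqrt (f x) * Real.sqrt (f x) = f x := Real.mul_self_sqrt h.le
        generalize Real.sqrt (f x) = s at *
        rw [← hsq, Real.log_mul hs.ne' hs.ne']
        have h2 := Real.one_sub_inv_le_log_of_pos hs
        have h3 : s * s * -(Real.log s + Real.log s) ≤ s * s * (2 * (s⁻¹ - 1)) := by
          apply mul_le_mul_of_nonneg_left _ (by positivity)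
          linarith
        have h4 : s * s * (2 * (s⁻¹ - 1)) = 2 * s - 2 * (s * s) := by
          field_simp
        nlinarith
    refine h1.trans ?_
    apply mul_le_mul_of_nonneg_left _ (by norm_num)
    rw [Real.sqrt_le_left (Real.exp_pos _).le, sq, ← Real.exp_add]
    have := hg.decay x
    rw [GG_of_nonneg hx.le] at this
    refine this.trans (le_of_eq ?_)
    congr 1
    ring

end MP

/-- main theorem: there is exactly one measurable non-increasing
solution `f : ℝ → [0,1]` of the un-truncated Mézard–Parisi cavity equation; the
extended truncated fixed points `f_λ` converge to `f` pointwise as `λ → ∞`, and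
the entropy integrals converge as well. -/
theorem mezard_parisi_main (d : ℝ) (hd : 1 < d)
    (F : ℝ → ℝ → ℝ) (hF : ∀ lam : ℝ, 0 < lam → ExtFixedPoint d lam (F lam)) :
    ∃ f : ℝ → ℝ, (Antitone f ∧ SolvesCavity d f) ∧
      (∀ g : ℝ → ℝ, Antitone g → SolvesCavity d g → g = f) ∧
      (∀ x : ℝ, Tendsto (fun lam : ℝ => F lam x) atTop (nhds (f x))) ∧
      Tendsto (fun lam : ℝ => ∫ x in (-lam)..lam, F lam x * Real.log (F lam x))
        atTop (nhds (∫ x : ℝ, f x * Real.log (f x))) := by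
  have hsub : ∀ ns : ℕ → ℝ, Tendsto ns atTop atTop → ∃ ms : ℕ → ℕ, ∃ f, MP.Sol d f ∧
      ∀ x, Tendsto (fun n => F (ns (ms n)) x) atTop (nhds (f x)) := by
    intro ns hns
    obtain ⟨N, hN⟩ := eventually_atTop.1 (hns.eventually_gt_atTop 0)
    have hpos : ∀ n, 0 < ns (n + N) := fun n => hN _ (by omega)
    have hns' : Tendsto (fun n => ns (n + N)) atTop atTop := hns.comp (tendsto_add_atTop_nat N)
    obtain ⟨φ, -, f, hf, hlim⟩ := MP.limitSol hd (Fn := fun n => F (ns (n + N)))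
      (fun n => (MP.ext_good hd (hpos n) (hF _ (hpos n))).1) (by
        intro x
        filter_upwards [hns'.eventually_ge_atTop |x|] with n hn
        exact (MP.ext_good hd (hpos n) (hF _ (hpos n))).2 x (abs_le.1 hn))
    exact ⟨fun n => φ n + N, f, hf, hlim⟩
  obtain ⟨-, f, hf, -⟩ := hsub (fun n => (n:ℝ)) tendsto_natCast_atTop_atTop
  have hlim : ∀ x : ℝ, Tendsto (fun lam : ℝ => F lam x) atTop (nhds (f x)) := by
    intro x
    apply tendsto_of_subseq_tendsto
    intro ns hns
    obtain ⟨ms, g, hg, h⟩ := hsub ns hns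
    refine ⟨ms, ?_⟩
    rw [MP.unique hd hf hg]
    exact h x
  refine ⟨f, ⟨hf.good.anti, hf.solves hd⟩, ?_, hlim, ?_⟩
  · intro g hga hg
    exact MP.unique hd (MP.Sol.of_solves hd hga hg) hf
  · have h1 : Tendsto (fun lam : ℝ => ∫ x, F lam x * Real.log (F lam x))
        atTop (nhds (∫ x : ℝ, f x * Real.log (f x))) := by
      apply tendsto_integral_filter_of_dominated_convergence (MP.BB d)
      · filter_upwards [eventually_gt_atTop 0] with lam hl
        exact (Real.continuous_mul_log.measurable.comp
          (MP.ext_good hd hl (hF _ hl)).1.anti.measurable).aestronglyMeasurable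
      · filter_upwards [eventually_gt_atTop 0] with lam hl
        exact Eventually.of_forall fun x => MP.ent_bound hd hl (hF _ hl) x
      · exact MP.BB_integrable hd
      · exact Eventually.of_forall fun x =>
          (Real.continuous_mul_log.tendsto (f x)).comp (hlim x)
    refine h1.congr' ?_
    filter_upwards [eventually_gt_atTop 0] with lam hl
    rw [intervalIntegral.integral_of_le (by linarith)]
    symm
    apply setIntegral_eq_integral_of_forall_compl_eq_zero
    intro x hx
    rcases le_or_gt x (-lam) with h | h
    · rw [(hF lam hl).2.2.1 x h]; simp
    · have : lam < x := by
        by_contra hcon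
        exact hx ⟨h, not_lt.1 hcon⟩
      rw [(hF lam hl).2.2.2.1 x this]; simp
end
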